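/- arXiv:1203.6086 — 2 statements merged into one kernel-verified Lean document; each statement's English description precedes it below -/
import Mathlib

section
/- Let R be a relational signature, ℱ a set of finite packed R-structures, ℒ a countable set of sparse link-structures, and T any countable R-structure. Then the class of finite T-colored structures (A,a) with A ∈ 𝒦_{ℒℱ} has the Hrushovski property: for every finite T-colored structure (A,a) with A ∈ 𝒦_{ℒℱ} there is a finite T-colored structure (B,b) with B ∈ 𝒦_{ℒℱ}, A a substructure of B and b restricting to a on A, such that every isomorphism p between substructures A₁, A₂ of A satisfying a ∘ p = a on A₁ extends to an automorphism f of B with b ∘ f = b. Moreover, if (U,u) is a universal homogeneous T-colored structure in 𝒦_{ℒℱ}-bar, then the strong automorphism group sAut(U,u) = { f ∈ Aut(U) : u ∘ f = u } has the small index property. -/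
open FirstOrder Language CategoryTheory

universe u v

namespace Stmt14

variable {L : FirstOrder.Language.{u, v}}

/-- The age of `M` is contained in the class `C` of finite structures. -/
def AgeIn (C : Set (Bundled.{0} L.Structure)) (M : Type*) [L.Structure M] : Prop :=
  ∀ A : Bundled.{0} L.Structure, Finite A → Nonempty (A ↪[L] M) → A ∈ C

/-- `A` is a countable structure whose age is contained in `C`, i.e. `A ∈ C̄`. -/
def InBar (C : Set (Bundled.{0} L.Structure)) (A : Bundled.{0} L.Structure) : Prop :=
  Countable A ∧ AgeIn C A

/-- `(U,u)` is a universal `T`-colored structure in `C̄`: every countable `T`-colored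
structure `(A,a)` in `C̄` admits an embedding `ι : A ↪ U` with `u ∘ ι = a`. -/
def ColUniversal (C : Set (Bundled.{0} L.Structure)) {T : Type*} [L.Structure T]
    (Ub : Bundled.{0} L.Structure) (u : Ub →[L] T) : Prop :=
  ∀ (A : Bundled.{0} L.Structure) (a : A →[L] T), InBar C A →
    ∃ ι : A ↪[L] Ub, ∀ x, u (ι x) = a x

/-- `(U,u)` is a homogeneous `T`-colored structure in `C̄`: any two embeddings of a finite
`T`-colored structure `(A,a)` of `C̄` into `(U,u)` differ by an automorphism of `(U,u)`. -/
def ColHomogeneous (C : Set (Bundled.{0} L.Structure)) {T : Type*} [L.Structure T]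
    (Ub : Bundled.{0} L.Structure) (u : Ub →[L] T) : Prop :=
  ∀ (A : Bundled.{0} L.Structure) (a : A →[L] T), InBar C A → Finite A →
    ∀ ι₁ ι₂ : A ↪[L] Ub, (∀ x, u (ι₁ x) = a x) → (∀ x, u (ι₂ x) = a x) →
      ∃ f : Ub ≃[L] Ub, (∀ y, u (f y) = u y) ∧ ∀ x, f (ι₁ x) = ι₂ x

/-- A finite link-structure: either a one-element structure or a structure whose
universe is covered by a single tuple belonging to a basic relation. -/
def IsLinkStructure (A : Bundled.{0} L.Structure) : Prop :=
  Finite A ∧ ((Nonempty A ∧ Subsingleton A) ∨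
    ∃ (n : ℕ) (r : L.Relations n) (t : Fin n → A),
      Structure.RelMap r t ∧ Function.Surjective t)

/-- A structure is sparse if only finitely many relation symbols have a nonempty
interpretation in it. -/
def Sparse (L : FirstOrder.Language.{u, v}) (A : Type*) [L.Structure A] : Prop :=
  {p : (n : ℕ) × L.Relations n | ∃ t : Fin p.1 → A, Structure.RelMap p.2 t}.Finite

/-- A structure is packed if any two distinct elements occur together in a tuple of a
basic relation. -/
def Packed (L : FirstOrder.Language.{u, v}) (A : Type*) [L.Structure A] : Prop :=
  ∀ x y : A, x ≠ y → ∃ (n : ℕ) (r : L.Relations n) (t : Fin n → A),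
    Structure.RelMap r t ∧ (∃ i, t i = x) ∧ ∃ j, t j = y

/-- A structure is `ℱ`-free if no member of `ℱ` admits a homomorphism into it. -/
def FFree (F : Set (Bundled.{0} L.Structure)) (A : Type*) [L.Structure A] : Prop :=
  ∀ X ∈ F, IsEmpty (X →[L] A)

/-- A structure has link type `ℒ` if each of its substructures that is a link-structure is
isomorphic to a member of `ℒ`. -/
def HasLinkType (Lk : Set (Bundled.{0} L.Structure)) (A : Type*) [L.Structure A] : Prop :=
  ∀ B : Bundled.{0} L.Structure, IsLinkStructure B → Nonempty (B ↪[L] A) →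
    ∃ X ∈ Lk, Nonempty (B ≃[L] X)

/-- `𝒦_{ℒℱ}`: the class of all finite `ℱ`-free structures of link type `ℒ`. -/
def KLF (Lk F : Set (Bundled.{0} L.Structure)) : Set (Bundled.{0} L.Structure) :=
  {A | Finite A ∧ FFree F A ∧ HasLinkType Lk A}

/-- The Hrushovski property for a class of finite structures: every member `A` extends to
a member `B` such that all isomorphisms between substructures of `A` extend to
automorphisms of `B`. -/
def Hrushovski (K : Set (Bundled.{0} L.Structure)) : Prop :=
  ∀ A ∈ K, ∃ B ∈ K, ∃ e : A ↪[L] B,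
    ∀ (S₁ S₂ : L.Substructure A) (p : S₁ ≃[L] S₂),
      ∃ f : B ≃[L] B, ∀ x : S₁, f (e (x : A)) = e ((p x : S₂) : A)

/-- `(D, g₁, g₂)` is a free amalgam of `B₁` and `B₂` over the common substructure given by
`f₁, f₂`: the disjoint union over it, with no additional relation tuples. -/
def IsFreeAmalgam {A B₁ B₂ D : Bundled.{0} L.Structure}
    (f₁ : A ↪[L] B₁) (f₂ : A ↪[L] B₂) (g₁ : B₁ ↪[L] D) (g₂ : B₂ ↪[L] D) : Prop :=
  (∀ x, g₁ (f₁ x) = g₂ (f₂ x)) ∧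
  (∀ d : D, (∃ x, g₁ x = d) ∨ ∃ y, g₂ y = d) ∧
  (∀ x y, g₁ x = g₂ y → ∃ a, f₁ a = x ∧ f₂ a = y) ∧
  ∀ (n : ℕ) (r : L.Relations n) (t : Fin n → D), Structure.RelMap r t →
    (∀ i, ∃ x, g₁ x = t i) ∨ ∀ i, ∃ y, g₂ y = t i

/-- A class of finite structures is closed under free amalgamation. -/
def FreeAmalgamClosed (K : Set (Bundled.{0} L.Structure)) : Prop :=
  ∀ A B₁ B₂ D : Bundled.{0} L.Structure, A ∈ K → B₁ ∈ K → B₂ ∈ K →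
    ∀ (f₁ : A ↪[L] B₁) (f₂ : A ↪[L] B₂) (g₁ : B₁ ↪[L] D) (g₂ : B₂ ↪[L] D),
      IsFreeAmalgam f₁ f₂ g₁ g₂ → D ∈ K

/-- The group of automorphisms of `M` belonging to the set `G` (assumed to be a subgroup
of `Aut(M)`) has the small index property: every subgroup `H` of `G` such that `G` is
covered by fewer than continuum many left cosets of `H` contains the pointwise stabilizer
(in `G`) of a finite tuple. -/
def HasSIPOn (L : FirstOrder.Language.{u, v}) (M : Type*) [L.Structure M]
    (G : Set (M ≃[L] M)) : Prop :=
  ∀ H : Set (M ≃[L] M), H ⊆ G →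
    Language.Equiv.refl L M ∈ H →
    (∀ f ∈ H, ∀ g ∈ H, f.comp g ∈ H) →
    (∀ f ∈ H, f.symm ∈ H) →
    (∃ S : Set (M ≃[L] M), Cardinal.mk S < Cardinal.continuum ∧
      ∀ f ∈ G, ∃ s ∈ S, ∃ h ∈ H, f = s.comp h) →
    ∃ (n : ℕ) (x : Fin n → M), ∀ f ∈ G, (∀ i, f (x i) = x i) → f ∈ H

section PermutationGroup

open Equiv

variable {M : Type*} [DecidableEq M]

/-- `G` is closed in `Perm M` for the topology of pointwise convergence. -/
def ClosedPerm (G : Subgroup (Perm M)) : Prop :=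
  ∀ g : Perm M, (∀ S : Finset M, ∃ g' ∈ G, ∀ x ∈ S, g' x = g x) → g ∈ G

/-- Finitely many partial maps with a common finite domain that come from elements of `G` are
restrictions of elements of `G` that preserve a common finite set. -/
def FiniteExtension (G : Subgroup (Perm M)) : Prop :=
  ∀ (n : ℕ) (g : ℕ → Perm M), (∀ i < n, g i ∈ G) → ∀ S : Finset M,
    ∃ D : Finset M, S ⊆ D ∧ ∃ g' : ℕ → Perm M,
      ∀ i < n, g' i ∈ G ∧ (∀ x ∈ S, g' i x = g i x) ∧ ∀ x ∈ D, g' i x ∈ D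

/-- Any finite `E₁` can be moved over `D` to a position independent from `E₂`, in the sense
that compatible permutations of the two sets have a common extension in `G`. -/
def FreeAmalgamation (G : Subgroup (Perm M)) : Prop :=
  ∀ D E₁ E₂ : Finset M, D ⊆ E₁ → D ⊆ E₂ → ∃ k ∈ G, (∀ x ∈ D, k x = x) ∧
    ∀ g₁ ∈ G, ∀ g₂ ∈ G, (∀ x ∈ E₁, g₁ x ∈ E₁) → (∀ x ∈ E₂, g₂ x ∈ E₂) →
      (∀ x ∈ D, g₁ x ∈ D) → (∀ x ∈ D, g₁ x = g₂ x) →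
      ∃ q ∈ G, (∀ x ∈ E₁, q (k x) = k (g₁ x)) ∧ ∀ x ∈ E₂, q x = g₂ x

/-- `D` is invariant under `a 0, …, a (n - 1)`. -/
def Inv (n : ℕ) (a : ℕ → Perm M) (D : Finset M) : Prop :=
  ∀ i < n, ∀ x ∈ D, a i x ∈ D

/-- The tuple `a 0, …, a (n - 1)` is a generic tuple of elements of `G`. -/
structure Generic (G : Subgroup (Perm M)) (n : ℕ) (a : ℕ → Perm M) : Prop where
  exists_inv : ∀ S : Finset M, ∃ D, S ⊆ D ∧ Inv n a D
  extend : ∀ (D E : Finset M) (g : ℕ → Perm M), D ⊆ E → Inv n a D → (∀ i < n, g i ∈ G) →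
    Inv n g E → (∀ i < n, ∀ x ∈ D, g i x = a i x) →
    ∃ k ∈ G, (∀ x ∈ D, k x = x) ∧ ∀ i < n, ∀ x ∈ E, a i (k x) = k (g i x)

/-- `W` contains a dense open subset of `G`. -/
def DenseOpen (G : Subgroup (Perm M)) (W : Perm M → Prop) : Prop :=
  ∀ c ∈ G, ∀ S : Finset M, ∃ c' ∈ G, (∀ x ∈ S, c' x = c x) ∧
    ∃ S' : Finset M, ∀ c'' ∈ G, (∀ x ∈ S', c'' x = c' x) → W c''

variable {G : Subgroup (Perm M)}

omit [DecidableEq M] in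
lemma Inv.succ_iff {n : ℕ} {a : ℕ → Perm M} {D : Finset M} :
    Inv (n + 1) a D ↔ Inv n a D ∧ ∀ x ∈ D, a n x ∈ D := by
  constructor
  · exact fun h => ⟨fun i hi => h i (by omega), h n (by omega)⟩
  · rintro ⟨h, h'⟩ i hi
    rcases Nat.lt_succ_iff_lt_or_eq.1 hi with hi | rfl
    exacts [h i hi, h']

omit [DecidableEq M] in
lemma Inv.update_iff {n : ℕ} {a : ℕ → Perm M} {c : Perm M} {D : Finset M} :
    Inv (n + 1) (Function.update a n c) D ↔ Inv n a D ∧ ∀ x ∈ D, c x ∈ D := by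
  rw [Inv.succ_iff, Function.update_self]
  refine and_congr_left' (forall₂_congr fun i hi => ?_)
  rw [Function.update_of_ne hi.ne]

lemma Inv.image {n : ℕ} {a b : ℕ → Perm M} {D : Finset M} (h : Inv n a D) (k : Perm M)
    (hk : ∀ i < n, ∀ x ∈ D, b i (k x) = k (a i x)) : Inv n b (D.image k) := by
  intro i hi y hy
  obtain ⟨x, hx, rfl⟩ := Finset.mem_image.1 hy
  rw [hk i hi x hx]
  exact Finset.mem_image_of_mem _ (h i hi x hx)

lemma Generic.zero (a : ℕ → Perm M) : Generic G 0 a where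
  exists_inv S := ⟨S, subset_rfl, fun i hi => by omega⟩
  extend D E g _ _ _ _ _ := ⟨1, one_mem _, fun _ _ => rfl, fun i hi => by omega⟩

omit [DecidableEq M] in
lemma exists_limit (hG : ClosedPerm G) (k : ℕ → Perm M) (D : ℕ → Finset M)
    (hk : ∀ m, k m ∈ G) (hagree : ∀ m m', m ≤ m' → ∀ x ∈ D m, k m' x = k m x)
    (hD : ∀ x, ∃ m, x ∈ D m) (hD' : ∀ x, ∃ m, (k m)⁻¹ x ∈ D m) :
    ∃ f ∈ G, ∀ m, ∀ x ∈ D m, f x = k m x := by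
  choose r hr using hD
  have key : ∀ m, ∀ x ∈ D m, k (r x) x = k m x := fun m x hx =>
    (hagree _ _ (le_max_left (r x) m) x (hr x)).symm.trans (hagree _ _ (le_max_right (r x) m) x hx)
  have key' : ∀ m x, r x ≤ m → k (r x) x = k m x := fun m x h => (hagree _ _ h x (hr x)).symm
  have hbij : Function.Bijective fun x => k (r x) x := by
    constructor
    · intro x y hxy
      dsimp only at hxy
      rw [key' (max (r x) (r y)) x (le_max_left _ _),
        key' (max (r x) (r y)) y (le_max_right _ _)] at hxy
      exact (k _).injective hxy
    · intro y
      obtain ⟨m, hm⟩ := hD' y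
      exact ⟨(k m)⁻¹ y, (key m _ hm).trans ((k m).apply_symm_apply y)⟩
  refine ⟨Equiv.ofBijective _ hbij, hG _ fun S => ?_, fun m x hx => key m x hx⟩
  exact ⟨k (S.sup r), hk _, fun x hx => (key' _ x (Finset.le_sup hx)).symm⟩

lemma exists_exhaustion (M : Type*) [Countable M] :
    ∃ S : ℕ → Finset M, Monotone S ∧ ∀ x, ∃ n, x ∈ S n := by
  obtain ⟨f, hf⟩ := exists_injective_nat M
  have hfin : ∀ n, {x | f x ≤ n}.Finite := fun n =>
    (Set.finite_Iic n).preimage hf.injOn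
  refine ⟨fun n => (hfin n).toFinset, fun m n h x hx => ?_, fun x => ⟨f x, by simp⟩⟩
  simp only [Set.Finite.mem_toFinset, Set.mem_ofPred_eq] at hx ⊢
  exact hx.trans h

/-- Baire category theorem for `G`. -/
lemma exists_mem_iInter [Countable M] (hG : ClosedPerm G) (W : ℕ → Perm M → Prop)
    (hW : ∀ j, DenseOpen G (W j)) (c : Perm M) (hc : c ∈ G) (S : Finset M) :
    ∃ y ∈ G, (∀ x ∈ S, y x = c x) ∧ ∀ j, W j y := by
  obtain ⟨T, -, hT⟩ := exists_exhaustion M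
  have step : ∀ (j : ℕ) (s : G × Finset M), ∃ s' : G × Finset M, s.2 ⊆ s'.2 ∧
      (∀ x ∈ s.2, s'.1.1 x = s.1.1 x) ∧ T j ⊆ s'.2 ∧ (∀ x ∈ T j, (s'.1.1)⁻¹ x ∈ s'.2) ∧
      ∀ y ∈ G, (∀ x ∈ s'.2, y x = s'.1.1 x) → W j y := by
    rintro j ⟨⟨k, hk⟩, S⟩
    obtain ⟨k', hk', h1, S', h2⟩ := hW j k hk S
    refine ⟨⟨⟨k', hk'⟩, S ∪ S' ∪ T j ∪ (T j).image (k'⁻¹ : Perm M)⟩, ?_, h1, ?_, ?_, ?_⟩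
    · intro x; simp +contextual
    · intro x; simp +contextual
    · intro x hx
      exact Finset.mem_union_right _ (Finset.mem_image_of_mem _ hx)
    · exact fun y hy h => h2 y hy fun x hx => h x (by simp [hx])
  choose F h1 h2 h3 h4 h5 using step
  let s : ℕ → G × Finset M := fun n => Nat.rec (⟨c, hc⟩, S) (fun j s => F j s) n
  have hs : ∀ n, s (n + 1) = F n (s n) := fun _ => rfl
  have hmono : Monotone fun n => (s n).2 := monotone_nat_of_le_succ fun n => h1 _ _
  have hagree : ∀ m m', m ≤ m' → ∀ x ∈ (s m).2, (s m').1.1 x = (s m).1.1 x := by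
    intro m m' h
    induction m', h using Nat.le_induction with
    | base => exact fun _ _ => rfl
    | succ m' h ih => exact fun x hx => (h2 m' (s m') x (hmono h hx)).trans (ih x hx)
  obtain ⟨y, hy, hyk⟩ := exists_limit hG (fun n => (s n).1.1) (fun n => (s n).2)
    (fun n => (s n).1.2) hagree
    (fun x => let ⟨n, hn⟩ := hT x; ⟨n + 1, h3 n _ hn⟩)
    (fun x => let ⟨n, hn⟩ := hT x; ⟨n + 1, h4 n _ x hn⟩)
  exact ⟨y, hy, hyk 0, fun j => h5 j (s j) y hy (hyk (j + 1))⟩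

/-- The first `n` bits of `α`, followed by zeros. -/
def trunc (n : ℕ) (α : ℕ → Bool) : ℕ → Bool := fun i => if i < n then α i else false

lemma trunc_trunc_succ (n : ℕ) (α : ℕ → Bool) : trunc n (trunc (n + 1) α) = trunc n α := by
  funext i
  by_cases h : i < n
  · simp [trunc, h, Nat.lt_succ_of_lt h]
  · simp [trunc, h]

lemma finite_range_trunc (n : ℕ) : (Set.range (trunc n)).Finite := by
  refine (Set.finite_range fun (β : Fin n → Bool) (i : ℕ) =>
    if h : i < n then β ⟨i, h⟩ else false).subset ?_
  rintro _ ⟨α, rfl⟩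
  exact ⟨fun i => α i, by funext i; simp [trunc]⟩

lemma exists_separated_family {ι : Type*} (W : ℕ → Perm M → Prop)
    (hW : ∀ j, DenseOpen G (W j)) (P : ι → Perm M) (hP : ∀ i, P i ∈ G)
    (S : Finset M) (Q : Finset (ι × ι × ℕ)) (hQ : ∀ q ∈ Q, q.1 ≠ q.2.1) :
    ∃ P' : ι → Perm M, (∀ i, P' i ∈ G) ∧ (∀ i, ∀ x ∈ S, P' i x = P i x) ∧
      ∃ S' : Finset M, S ⊆ S' ∧ ∀ q ∈ Q, ∀ y ∈ G, ∀ z ∈ G, (∀ x ∈ S', y x = P' q.1 x) →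
        (∀ x ∈ S', z x = P' q.2.1 x) → W q.2.2 (y⁻¹ * z) := by
  classical
  induction Q using Finset.induction_on with
  | empty => exact ⟨P, hP, fun _ _ _ => rfl, S, subset_rfl, by simp⟩
  | insert q Q _ ih =>
    obtain ⟨P₁, hP₁, hPS, S₁, hS₁, h⟩ := ih fun q hq => hQ q (Finset.mem_insert_of_mem hq)
    obtain ⟨i, j, m⟩ := q
    have hij : i ≠ j := hQ _ (Finset.mem_insert_self _ _)
    obtain ⟨c, hc, hcS, Sc, hSc⟩ := hW m ((P₁ i)⁻¹ * P₁ j)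
      (mul_mem (inv_mem (hP₁ i)) (hP₁ j)) S₁
    have hagree : ∀ l, ∀ x ∈ S₁, Function.update P₁ j (P₁ i * c) l x = P₁ l x := by
      intro l x hx
      rcases eq_or_ne l j with rfl | hl
      · simp [hcS x hx]
      · simp [Function.update_of_ne hl]
    refine ⟨Function.update P₁ j (P₁ i * c), ?_, fun l x hx => (hagree l x (hS₁ hx)).trans
      (hPS l x hx), S₁ ∪ Sc ∪ Sc.image c, ?_, ?_⟩
    · intro l
      rcases eq_or_ne l j with rfl | hl
      · simpa using mul_mem (hP₁ i) hc
      · simpa [Function.update_of_ne hl] using hP₁ l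
    · exact hS₁.trans (by intro x; simp +contextual)
    · intro q hq y hy z hz hyS hzS
      rcases Finset.mem_insert.1 hq with rfl | hq
      · refine hSc _ (mul_mem (inv_mem hy) hz) fun x hx => ?_
        have h1 := hzS x (by simp [hx])
        have h2 := hyS (c x) (by simp [hx])
        simp only [Function.update_self, Function.update_of_ne hij] at h1 h2
        rw [Perm.mul_apply, h1, Perm.mul_apply, ← h2]
        exact y.symm_apply_apply _
      · exact h q hq y hy z hz
          (fun x hx => (hyS x (by simp [hx])).trans (hagree _ x hx))
          (fun x hx => (hzS x (by simp [hx])).trans (hagree _ x hx))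

/-- Mycielski's theorem for `G`: a perfect family with all quotients in a comeager set. -/
lemma exists_perfect_family [Countable M] (hG : ClosedPerm G) (W : ℕ → Perm M → Prop)
    (hW : ∀ j, DenseOpen G (W j)) :
    ∃ h : (ℕ → Bool) → Perm M, (∀ α, h α ∈ G) ∧
      ∀ α β, α ≠ β → ∀ j, W j ((h α)⁻¹ * h β) := by
  classical
  obtain ⟨T, -, hT⟩ := exists_exhaustion M
  have step : ∀ (n : ℕ) (s : ((ℕ → Bool) → G) × Finset M),
      ∃ s' : ((ℕ → Bool) → G) × Finset M, s.2 ⊆ s'.2 ∧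
      (∀ α, ∀ x ∈ s.2, (s'.1 (trunc (n + 1) α)).1 x = (s.1 (trunc n α)).1 x) ∧ T n ⊆ s'.2 ∧
      (∀ α, ∀ x ∈ T n, (s'.1 (trunc (n + 1) α)).1⁻¹ x ∈ s'.2) ∧
      ∀ α β, trunc (n + 1) α ≠ trunc (n + 1) β → ∀ j ≤ n, ∀ y ∈ G, ∀ z ∈ G,
        (∀ x ∈ s'.2, y x = (s'.1 (trunc (n + 1) α)).1 x) →
        (∀ x ∈ s'.2, z x = (s'.1 (trunc (n + 1) β)).1 x) → W j (y⁻¹ * z) := by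
    rintro n ⟨P, S⟩
    let I := (finite_range_trunc (n + 1)).toFinset
    have hI : ∀ α, trunc (n + 1) α ∈ I := fun α => by simp [I]
    obtain ⟨P', hP', h1, S', hS', h2⟩ := exists_separated_family W hW
      (fun α => (P (trunc n α)).1) (fun α => (P _).2) S
      ((I ×ˢ I ×ˢ Finset.range (n + 1)).filter fun q => q.1 ≠ q.2.1)
      (fun q hq => (Finset.mem_filter.1 hq).2)
    refine ⟨⟨fun α => ⟨P' α, hP' α⟩, S' ∪ T n ∪ I.biUnion fun α => (T n).image ((P' α)⁻¹ : Perm M)⟩,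
      ?_, ?_, ?_, ?_, ?_⟩
    · exact hS'.trans (by intro x; simp +contextual)
    · intro α x hx
      simpa [trunc_trunc_succ] using h1 (trunc (n + 1) α) x hx
    · intro x; simp +contextual
    · intro α x hx
      exact Finset.mem_union_right _ (Finset.mem_biUnion.2
        ⟨_, hI α, Finset.mem_image_of_mem _ hx⟩)
    · intro α β hαβ j hj y hy z hz hyS hzS
      refine h2 (trunc (n + 1) α, trunc (n + 1) β, j) ?_ y hy z hz
        (fun x hx => hyS x (by simp [hx])) (fun x hx => hzS x (by simp [hx]))
      simp [hI, hαβ, hj]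
  choose F h1 h2 h3 h4 h5 using step
  let s : ℕ → ((ℕ → Bool) → G) × Finset M :=
    fun n => Nat.rec (fun _ => 1, ∅) (fun j s => F j s) n
  have hmono : Monotone fun n => (s n).2 := monotone_nat_of_le_succ fun n => h1 _ _
  have hagree : ∀ α m m', m ≤ m' → ∀ x ∈ (s m).2,
      ((s m').1 (trunc m' α)).1 x = ((s m).1 (trunc m α)).1 x := by
    intro α m m' h
    induction m', h using Nat.le_induction with
    | base => exact fun _ _ => rfl
    | succ m' h ih => exact fun x hx => (h2 m' (s m') α x (hmono h hx)).trans (ih x hx)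
  have hlim := fun α => exists_limit hG (fun n => ((s n).1 (trunc n α)).1) (fun n => (s n).2)
    (fun n => ((s n).1 _).2) (hagree α)
    (fun x => let ⟨n, hn⟩ := hT x; ⟨n + 1, h3 n _ hn⟩)
    (fun x => let ⟨n, hn⟩ := hT x; ⟨n + 1, h4 n _ α x hn⟩)
  choose h hhG hh using hlim
  refine ⟨h, hhG, fun α β hαβ j => ?_⟩
  obtain ⟨i, hi⟩ := Function.ne_iff.1 hαβ
  refine h5 (max i j) (s (max i j)) α β ?_ j (le_max_right _ _) _ (hhG α) _ (hhG β)
    (hh α (max i j + 1)) (hh β (max i j + 1))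
  intro h
  have := congrFun h i
  simp only [trunc, Nat.lt_succ_of_le (le_max_left i j), if_true] at this
  exact hi this

/-- Any element of `G` agrees on a given finite set with one that, together with a given generic
tuple, preserves a larger finite set. -/
lemma Generic.exists_inv_extension {n : ℕ} {a : ℕ → Perm M} (hfin : FiniteExtension G)
    (haG : ∀ i < n, a i ∈ G) (ha : Generic G n a) (c : Perm M) (hc : c ∈ G) (S : Finset M) :
    ∃ p ∈ G, (∀ x ∈ S, p x = c x) ∧ ∃ D, S ⊆ D ∧ Inv n a D ∧ ∀ x ∈ D, p x ∈ D := by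
  obtain ⟨E₀, hE₀, hinv₀⟩ := ha.exists_inv (S ∪ S.image c)
  obtain ⟨E, hE, g, hg⟩ := hfin (n + 1) (Function.update a n c) (by
    intro i hi
    rcases Nat.lt_succ_iff_lt_or_eq.1 hi with hi | rfl
    · rw [Function.update_of_ne hi.ne]; exact haG i hi
    · rwa [Function.update_self]) E₀
  have hgn := hg n (by omega)
  rw [Function.update_self] at hgn
  obtain ⟨k, hk, hkE₀, hkE⟩ := ha.extend E₀ E g hE hinv₀ (fun i hi => (hg i (by omega)).1)
    (fun i hi => (hg i (by omega)).2.2) (fun i hi x hx => by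
      rw [(hg i (by omega)).2.1 x hx, Function.update_of_ne hi.ne])
  have hinv : Inv n g E := fun i hi => (hg i (by omega)).2.2
  refine ⟨k * g n * k⁻¹, mul_mem (mul_mem hk hgn.1) (inv_mem hk), ?_, E.image k, ?_,
    hinv.image k hkE, ?_⟩
  · intro x hx
    have hx₀ : x ∈ E₀ := hE₀ (by simp [hx])
    have hcx : c x ∈ E₀ := hE₀ (by simp only [Finset.mem_union, Finset.mem_image]; exact .inr ⟨x, hx, rfl⟩)
    have : k⁻¹ x = x := k.symm_apply_eq.2 (hkE₀ x hx₀).symm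
    rw [Perm.mul_apply, Perm.mul_apply, this, hgn.2.1 x hx₀, hkE₀ _ hcx]
  · intro x hx
    have hx₀ : x ∈ E₀ := hE₀ (by simp [hx])
    exact Finset.mem_image.2 ⟨x, hE hx₀, hkE₀ x hx₀⟩
  · intro y hy
    obtain ⟨x, hx, rfl⟩ := Finset.mem_image.1 hy
    have : k⁻¹ (k x) = x := k.symm_apply_apply x
    rw [Perm.mul_apply, Perm.mul_apply, this]
    exact Finset.mem_image_of_mem _ (hgn.2.2 x hx)

lemma Generic.dense_extend {n : ℕ} {a : ℕ → Perm M} (ham : FreeAmalgamation G)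
    (haG : ∀ i < n, a i ∈ G) (ha : Generic G n a) (p : Perm M) (hp : p ∈ G)
    (D D₁ E : Finset M) (hD : Inv n a D) (hpD : ∀ x ∈ D, p x ∈ D) (hD₁ : D₁ ⊆ D)
    (g : ℕ → Perm M) (hDE : D₁ ⊆ E) (hD₁inv : Inv (n + 1) (Function.update a n p) D₁)
    (hgG : ∀ i < n + 1, g i ∈ G) (hgE : Inv (n + 1) g E)
    (hga : ∀ i < n + 1, ∀ x ∈ D₁, g i x = Function.update a n p i x) :
    ∃ p' ∈ G, (∀ x ∈ D, p' x = p x) ∧ ∃ k ∈ G, (∀ x ∈ D₁, k x = x) ∧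
      ∀ i < n + 1, ∀ x ∈ E, Function.update a n p' i (k x) = k (g i x) := by
  obtain ⟨k₁, hk₁, hk₁D, hq⟩ := ham D₁ E D hDE hD₁
  have hq' : ∀ i, ∃ q, i < n + 1 → q ∈ G ∧ (∀ x ∈ E, q (k₁ x) = k₁ (g i x)) ∧
      ∀ x ∈ D, q x = Function.update a n p i x := by
    intro i
    by_cases hi : i < n + 1
    · obtain ⟨q, h⟩ := hq (g i) (hgG i hi) (Function.update a n p i) (by
        rcases Nat.lt_succ_iff_lt_or_eq.1 hi with hi | rfl
        · rw [Function.update_of_ne hi.ne]; exact haG i hi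
        · rwa [Function.update_self]) (hgE i hi) (Inv.update_iff.2 ⟨hD, hpD⟩ i hi)
        (fun x hx => by rw [hga i hi x hx]; exact hD₁inv i hi x hx) (hga i hi)
      exact ⟨q, fun _ => h⟩
    · exact ⟨1, fun h => absurd h hi⟩
  choose q hq using hq'
  have hqW : ∀ i < n + 1, ∀ x ∈ E.image k₁ ∪ D, q i x ∈ E.image k₁ ∪ D := by
    intro i hi x hx
    rcases Finset.mem_union.1 hx with hx | hx
    · obtain ⟨x, hxE, rfl⟩ := Finset.mem_image.1 hx
      rw [(hq i hi).2.1 x hxE]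
      exact Finset.mem_union_left _ (Finset.mem_image_of_mem _ (hgE i hi x hxE))
    · rw [(hq i hi).2.2 x hx]
      exact Finset.mem_union_right _ (Inv.update_iff.2 ⟨hD, hpD⟩ i hi x hx)
  obtain ⟨k₂, hk₂, hk₂D, hk₂q⟩ := ha.extend D (E.image k₁ ∪ D) q Finset.subset_union_right hD
    (fun i hi => (hq i (by omega)).1) (fun i hi => hqW i (by omega))
    (fun i hi x hx => by rw [(hq i (by omega)).2.2 x hx, Function.update_of_ne hi.ne])
  have hqn := hq n (by omega)
  rw [Function.update_self] at hqn
  refine ⟨k₂ * q n * k₂⁻¹, mul_mem (mul_mem hk₂ hqn.1) (inv_mem hk₂), ?_, k₂ * k₁,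
    mul_mem hk₂ hk₁, ?_, ?_⟩
  · intro x hx
    have : k₂⁻¹ x = x := k₂.symm_apply_eq.2 (hk₂D x hx).symm
    rw [Perm.mul_apply, Perm.mul_apply, this, hqn.2.2 x hx, hk₂D _ (hpD x hx)]
  · intro x hx
    rw [Perm.mul_apply, hk₁D x hx, hk₂D x (hD₁ hx)]
  · intro i hi x hx
    rw [Perm.mul_apply, Perm.mul_apply, ← (hq i hi).2.1 x hx]
    rcases Nat.lt_succ_iff_lt_or_eq.1 hi with hi | rfl
    · rw [Function.update_of_ne hi.ne]
      exact hk₂q i hi _ (Finset.mem_union_left _ (Finset.mem_image_of_mem _ hx))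
    · rw [Function.update_self]
      have : k₂⁻¹ (k₂ (k₁ x)) = k₁ x := k₂.symm_apply_apply _
      rw [Perm.mul_apply, Perm.mul_apply, this]

/-- Comeagerly many elements of `G` extend a given generic tuple to a generic tuple. -/
lemma Generic.exists_denseOpen [Countable M] {n : ℕ} {a : ℕ → Perm M} (hfin : FiniteExtension G)
    (ham : FreeAmalgamation G) (haG : ∀ i < n, a i ∈ G) (ha : Generic G n a) :
    ∃ W : ℕ → Perm M → Prop, (∀ j, DenseOpen G (W j)) ∧
      ∀ c, (∀ j, W j c) → Generic G (n + 1) (Function.update a n c) := by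
  let I := Finset M ⊕ (Finset M × Finset M × (Fin (n + 1) → Finset (M × M)))
  obtain ⟨f, hf⟩ := exists_surjective_nat I
  let V : I → Perm M → Prop := fun ι c => match ι with
    | .inl S => ∃ D, S ⊆ D ∧ Inv (n + 1) (Function.update a n c) D
    | .inr ⟨D, E, γ⟩ => ∀ g : ℕ → Perm M, D ⊆ E → Inv (n + 1) (Function.update a n c) D →
        (∀ i < n + 1, g i ∈ G) → Inv (n + 1) g E →
        (∀ i < n + 1, ∀ x ∈ D, g i x = Function.update a n c i x) →
        (∀ i : Fin (n + 1), E.image (fun x => (x, g i x)) = γ i) →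
        ∃ k ∈ G, (∀ x ∈ D, k x = x) ∧
          ∀ i < n + 1, ∀ x ∈ E, Function.update a n c i (k x) = k (g i x)
  have hV : ∀ ι, DenseOpen G (V ι) := by
    rintro (S | ⟨D₁, E, γ⟩) c hc S₀
    · obtain ⟨p, hp, hpS, D, hSD, hD, hpD⟩ := ha.exists_inv_extension hfin haG c hc (S₀ ∪ S)
      refine ⟨p, hp, fun x hx => hpS x (by simp [hx]), D, fun c'' hc'' h => ⟨D,
        fun x hx => hSD (by simp [hx]), Inv.update_iff.2 ⟨hD, fun x hx => ?_⟩⟩⟩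
      rw [h x hx]
      exact hpD x hx
    · obtain ⟨p, hp, hpS, D, hSD, hD, hpD⟩ := ha.exists_inv_extension hfin haG c hc (S₀ ∪ D₁)
      have hD₁ : D₁ ⊆ D := fun x hx => hSD (by simp [hx])
      have hS₀ : S₀ ⊆ D := fun x hx => hSD (by simp [hx])
      have hpS₀ : ∀ x ∈ S₀, p x = c x := fun x hx => hpS x (by simp [hx])
      have hupd : ∀ c'' : Perm M, (∀ x ∈ D, c'' x = p x) → ∀ i, ∀ x ∈ D,
          Function.update a n c'' i x = Function.update a n p i x := by
        intro c'' h i x hx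
        rcases eq_or_ne i n with rfl | hi
        · simp [h x hx]
        · simp [Function.update_of_ne hi]
      by_cases hg : ∃ g : ℕ → Perm M, D₁ ⊆ E ∧ Inv (n + 1) (Function.update a n p) D₁ ∧
          (∀ i < n + 1, g i ∈ G) ∧ Inv (n + 1) g E ∧
          (∀ i < n + 1, ∀ x ∈ D₁, g i x = Function.update a n p i x) ∧
          (∀ i : Fin (n + 1), E.image (fun x => (x, g i x)) = γ i)
      · obtain ⟨g, h1, h2, h3, h4, h5, h6⟩ := hg
        obtain ⟨p', hp', hp'D, k, hk, hkD, hkE⟩ :=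
          ha.dense_extend ham haG p hp D D₁ E hD hpD hD₁ g h1 h2 h3 h4 h5
        refine ⟨p', hp', fun x hx => (hp'D x (hS₀ hx)).trans (hpS₀ x hx), E.image k,
          fun c'' hc'' hcS g' _ _ _ _ _ h6' => ⟨k, hk, hkD, fun i hi x hx => ?_⟩⟩
        have hgg : g' i x = g i x := by
          have h : (x, g' i x) ∈ γ ⟨i, hi⟩ := by
            rw [← h6' ⟨i, hi⟩]; exact Finset.mem_image.2 ⟨x, hx, rfl⟩
          rw [← h6 ⟨i, hi⟩] at h
          obtain ⟨y, _, hy⟩ := Finset.mem_image.1 h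
          obtain ⟨rfl, hy⟩ := Prod.mk.inj hy
          exact hy.symm
        rw [hgg, ← hkE i hi x hx]
        rcases eq_or_ne i n with rfl | hin
        · simpa using hcS (k x) (Finset.mem_image_of_mem _ hx)
        · simp [Function.update_of_ne hin]
      · refine ⟨p, hp, hpS₀, D, fun c'' hc'' hcD g' h1 h2 h3 h4 h5 h6 => absurd ?_ hg⟩
        refine ⟨g', h1, fun i hi x hx => ?_, h3, h4, fun i hi x hx => ?_, h6⟩
        · rw [← hupd c'' hcD i x (hD₁ hx)]; exact h2 i hi x hx
        · rw [← hupd c'' hcD i x (hD₁ hx)]; exact h5 i hi x hx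
  refine ⟨fun j => V (f j), fun j => hV _, fun c hc => ?_⟩
  have hc' : ∀ ι, V ι c := fun ι => by obtain ⟨j, rfl⟩ := hf ι; exact hc j
  exact ⟨fun S => hc' (.inl S), fun D E g h1 h2 h3 h4 h5 =>
    hc' (.inr ⟨D, E, fun i => E.image fun x => (x, g i x)⟩) g h1 h2 h3 h4 h5 fun _ => rfl⟩

/-- `k` restricts on `D` to an isomorphism from `a` to `b`, where `D` is finite `a`-invariant. -/
structure PartialConj (G : Subgroup (Perm M)) (n : ℕ) (a b : ℕ → Perm M) (k : Perm M)
    (D : Finset M) : Prop where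
  mem : k ∈ G
  inv : Inv n a D
  comm : ∀ i < n, ∀ x ∈ D, k (a i x) = b i (k x)

lemma PartialConj.symm {n : ℕ} {a b : ℕ → Perm M} {k : Perm M} {D : Finset M}
    (h : PartialConj G n a b k D) : PartialConj G n b a k⁻¹ (D.image k) where
  mem := inv_mem h.mem
  inv := h.inv.image k fun i hi x hx => (h.comm i hi x hx).symm
  comm i hi y hy := by
    obtain ⟨x, hx, rfl⟩ := Finset.mem_image.1 hy
    have : k⁻¹ (k x) = x := k.symm_apply_apply x
    rw [this, ← h.comm i hi x hx]
    exact k.symm_apply_apply _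

lemma PartialConj.forth {n : ℕ} {a b : ℕ → Perm M} {k : Perm M} {D : Finset M}
    (h : PartialConj G n a b k D) (haG : ∀ i < n, a i ∈ G) (ha : Generic G n a)
    (hb : Generic G n b) (S : Finset M) :
    ∃ k' D', PartialConj G n a b k' D' ∧ D ⊆ D' ∧ S ⊆ D' ∧ ∀ x ∈ D, k' x = k x := by
  obtain ⟨D', hD', hinv⟩ := ha.exists_inv (D ∪ S)
  have hDD' : D ⊆ D' := fun x hx => hD' (by simp [hx])
  have happ : ∀ x, k⁻¹ (k x) = x := k.symm_apply_apply
  obtain ⟨k', hk', hk'D, hk'E⟩ := hb.extend (D.image k) (D'.image k) (fun i => k * a i * k⁻¹)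
    (Finset.image_subset_image hDD') h.symm.inv
    (fun i hi => mul_mem (mul_mem h.mem (haG i hi)) (inv_mem h.mem))
    (hinv.image k fun i hi x hx => by simp)
    (fun i hi y hy => by
      obtain ⟨x, hx, rfl⟩ := Finset.mem_image.1 hy
      rw [← h.comm i hi x hx]
      simp)
  refine ⟨k' * k, D', ⟨mul_mem hk' h.mem, hinv, fun i hi x hx => ?_⟩, hDD',
    fun x hx => hD' (by simp [hx]), fun x hx => hk'D _ (Finset.mem_image_of_mem _ hx)⟩
  have := hk'E i hi (k x) (Finset.mem_image_of_mem _ hx)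
  simp only [Perm.mul_apply, happ] at this ⊢
  exact this.symm

/-- Two generic tuples agreeing on a common invariant finite set are conjugate over it. -/
lemma Generic.exists_conj [Countable M] (hG : ClosedPerm G) {n : ℕ} {a b : ℕ → Perm M}
    (haG : ∀ i < n, a i ∈ G) (hbG : ∀ i < n, b i ∈ G)
    (ha : Generic G n a) (hb : Generic G n b) (D : Finset M) (hD : Inv n a D)
    (hab : ∀ i < n, ∀ x ∈ D, a i x = b i x) :
    ∃ f ∈ G, (∀ x ∈ D, f x = x) ∧ ∀ i < n, f * a i = b i * f := by
  obtain ⟨T, -, hT⟩ := exists_exhaustion M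
  let X := {s : Perm M × Finset M // PartialConj G n a b s.1 s.2}
  have step : ∀ (m : ℕ) (s : X), ∃ s' : X, s.1.2 ⊆ s'.1.2 ∧
      (∀ x ∈ s.1.2, s'.1.1 x = s.1.1 x) ∧ T m ⊆ s'.1.2 ∧ ∀ x ∈ T m, s'.1.1⁻¹ x ∈ s'.1.2 := by
    rintro m ⟨⟨k, D⟩, h⟩
    obtain ⟨k₁, D₁, h₁, hDD₁, hT₁, hk₁⟩ := h.forth haG ha hb (T m)
    obtain ⟨k₂, D₂, h₂, hDD₂, hT₂, hk₂⟩ := h₁.symm.forth hbG hb ha (T m)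
    have hk₂' : ∀ x ∈ D₁, k₂ (k₁ x) = x := fun x hx =>
      (hk₂ _ (Finset.mem_image_of_mem _ hx)).trans (k₁.symm_apply_apply x)
    have hD₁ : D₁ ⊆ D₂.image k₂ := fun x hx => Finset.mem_image.2
      ⟨k₁ x, hDD₂ (Finset.mem_image_of_mem _ hx), hk₂' x hx⟩
    refine ⟨⟨(k₂⁻¹, D₂.image k₂), h₂.symm⟩, hDD₁.trans hD₁, fun x hx => ?_, hT₁.trans hD₁,
      fun x hx => ?_⟩
    · rw [← hk₁ x hx]
      exact k₂.symm_apply_eq.2 (hk₂' x (hDD₁ hx)).symm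
    · simpa using Finset.mem_image_of_mem k₂ (hT₂ hx)
  choose F h1 h2 h3 h4 using step
  let s : ℕ → X := fun m => Nat.rec ⟨(1, D), one_mem _, hD, hab⟩ (fun j s => F j s) m
  have hmono : Monotone fun m => (s m).1.2 := monotone_nat_of_le_succ fun n => h1 _ _
  have hagree : ∀ m m', m ≤ m' → ∀ x ∈ (s m).1.2, (s m').1.1 x = (s m).1.1 x := by
    intro m m' h
    induction m', h using Nat.le_induction with
    | base => exact fun _ _ => rfl
    | succ m' h ih => exact fun x hx => (h2 m' (s m') x (hmono h hx)).trans (ih x hx)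
  have hex : ∀ x, ∃ m, x ∈ (s m).1.2 :=
    fun x => let ⟨n, hn⟩ := hT x; ⟨n + 1, h3 n _ hn⟩
  obtain ⟨f, hf, hfk⟩ := exists_limit hG (fun n => (s n).1.1) (fun n => (s n).1.2)
    (fun n => (s n).2.mem) hagree hex
    (fun x => let ⟨n, hn⟩ := hT x; ⟨n + 1, h4 n _ x hn⟩)
  refine ⟨f, hf, hfk 0, fun i hi => Equiv.ext fun x => ?_⟩
  obtain ⟨m, hm⟩ := hex x
  rw [Perm.mul_apply, Perm.mul_apply, hfk m x hm, hfk m _ ((s m).2.inv i hi x hm)]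
  exact (s m).2.comm i hi x hm

/-- The branching step in the construction of continuum many cosets of a subgroup that is not
open. -/
lemma Generic.exists_branching [Countable M] (hG : ClosedPerm G) (hfin : FiniteExtension G)
    (ham : FreeAmalgamation G) (H : Subgroup (Perm M))
    (hopen : ∀ D : Finset M, ∃ f ∈ G, (∀ x ∈ D, f x = x) ∧ f ∉ H)
    (hsmall : ∀ h : (ℕ → Bool) → Perm M, (∀ α, h α ∈ G) →
      ∃ α β, α ≠ β ∧ (h α)⁻¹ * h β ∈ H)
    {n : ℕ} {a : ℕ → Perm M} (haG : ∀ i < n, a i ∈ G) (ha : Generic G n a) (S : Finset M) :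
    ∃ c₀ ∈ G, ∃ c₁ ∈ G, Generic G (n + 1) (Function.update a n c₀) ∧
      Generic G (n + 1) (Function.update a n c₁) ∧ c₀ ∈ H ∧ c₁ ∉ H ∧
      ∃ f ∈ G, (∀ x ∈ S, f x = x) ∧ (∀ i < n, f * a i = a i * f) ∧ f * c₀ = c₁ * f := by
  obtain ⟨W, hW, hWgen⟩ := ha.exists_denseOpen hfin ham haG
  obtain ⟨c₀, hc₀G, hc₀W, hc₀H⟩ : ∃ c ∈ G, (∀ j, W j c) ∧ c ∈ H := by
    obtain ⟨h, hhG, hh⟩ := exists_perfect_family hG W hW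
    obtain ⟨α, β, hαβ, hH⟩ := hsmall h hhG
    exact ⟨_, mul_mem (inv_mem (hhG α)) (hhG β), hh α β hαβ, hH⟩
  obtain ⟨D, hSD, hD⟩ := (hWgen c₀ hc₀W).exists_inv S
  obtain ⟨c₁, hc₁G, hc₁D, hc₁W, hc₁H⟩ :
      ∃ c ∈ G, (∀ x ∈ D, c x = c₀ x) ∧ (∀ j, W j c) ∧ c ∉ H := by
    by_contra! hcon
    obtain ⟨g, hgG, hgD, hgH⟩ := hopen D
    have hW' : ∀ j, DenseOpen G fun c => W j (c * g) := by
      intro j c hc T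
      obtain ⟨c', hc', h1, T', h2⟩ := hW j (c * g) (mul_mem hc hgG) (T.image (g⁻¹ : Perm M))
      have happ : ∀ x, g (g⁻¹ x) = x := g.apply_symm_apply
      refine ⟨c' * g⁻¹, mul_mem hc' (inv_mem hgG), fun x hx => ?_, T'.image g,
        fun c'' hc'' h => h2 _ (mul_mem hc'' hgG) fun x hx => ?_⟩
      · have := h1 (g⁻¹ x) (Finset.mem_image_of_mem _ hx)
        rwa [Perm.mul_apply, happ] at this
      · have := h (g x) (Finset.mem_image_of_mem _ hx)
        rw [Perm.mul_apply, this]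
        simp
    obtain ⟨y, hyG, hyD, hy⟩ := exists_mem_iInter hG
      (fun j c => if j % 2 = 0 then W (j / 2) c else W (j / 2) (c * g))
      (fun j => by
        by_cases hj : j % 2 = 0
        · simpa [hj] using hW (j / 2)
        · simpa [hj] using hW' (j / 2)) c₀ hc₀G D
    have hyH : y ∈ H := hcon y hyG hyD fun j => by simpa using hy (2 * j)
    have hygH : y * g ∈ H := hcon (y * g) (mul_mem hyG hgG)
      (fun x hx => by rw [Perm.mul_apply, hgD x hx, hyD x hx]) fun j => by
        have := hy (2 * j + 1)
        rwa [if_neg (by omega), show (2 * j + 1) / 2 = j by omega] at this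
    exact hgH (by simpa using mul_mem (inv_mem hyH) hygH)
  have hmem : ∀ c ∈ G, ∀ i < n + 1, Function.update a n c i ∈ G := by
    intro c hc i hi
    rcases Nat.lt_succ_iff_lt_or_eq.1 hi with hi | rfl
    · rw [Function.update_of_ne hi.ne]; exact haG i hi
    · rwa [Function.update_self]
  obtain ⟨f, hfG, hfD, hf⟩ := Generic.exists_conj hG (hmem c₀ hc₀G) (hmem c₁ hc₁G)
    (hWgen c₀ hc₀W) (hWgen c₁ hc₁W) D hD (by
      intro i hi x hx
      rcases Nat.lt_succ_iff_lt_or_eq.1 hi with hi | rfl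
      · rw [Function.update_of_ne hi.ne, Function.update_of_ne hi.ne]
      · simp [hc₁D x hx])
  refine ⟨c₀, hc₀G, c₁, hc₁G, hWgen c₀ hc₀W, hWgen c₁ hc₁W, hc₀H, hc₁H, f, hfG,
    fun x hx => hfD x (hSD hx), fun i hi => ?_, ?_⟩
  · have := hf i (by omega)
    rwa [Function.update_of_ne hi.ne, Function.update_of_ne hi.ne] at this
  · simpa using hf n (by omega)

/-- A subgroup of `G` of small index contains the stabilizer of a finite set. -/
theorem exists_stabilizer_le [Countable M] (hG : ClosedPerm G) (hfin : FiniteExtension G)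
    (ham : FreeAmalgamation G) (H : Subgroup (Perm M))
    (hsmall : ∀ h : (ℕ → Bool) → Perm M, (∀ α, h α ∈ G) →
      ∃ α β, α ≠ β ∧ (h α)⁻¹ * h β ∈ H) :
    ∃ D : Finset M, ∀ f ∈ G, (∀ x ∈ D, f x = x) → f ∈ H := by
  by_contra! hopen
  obtain ⟨T, hTmono, hT⟩ := exists_exhaustion M
  let X (n : ℕ) := {s : (ℕ → Perm M) × Perm M //
    (∀ i < n, s.1 i ∈ G) ∧ Generic G n s.1 ∧ s.2 ∈ G}
  have hmem : ∀ {n : ℕ} {a : ℕ → Perm M} {c}, c ∈ G → (∀ i < n, a i ∈ G) →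
      ∀ i < n + 1, Function.update a n c i ∈ G := by
    intro n a c hc haG i hi
    rcases Nat.lt_succ_iff_lt_or_eq.1 hi with hi | rfl
    · rw [Function.update_of_ne hi.ne]; exact haG i hi
    · rwa [Function.update_self]
  have step : ∀ (n : ℕ) (s : X n), ∃ s' : Bool → X (n + 1),
      (∀ b, ∀ i < n, (s' b).1.1 i = s.1.1 i) ∧
      (∀ b, ∀ i < n, ∀ z, s.1.2 * s.1.1 i = z * s.1.2 → (s' b).1.2 * s.1.1 i = z * (s' b).1.2) ∧
      (∀ b, ∀ x ∈ T n ∪ (T n).image (s.1.2⁻¹ : Perm M), (s' b).1.2 x = s.1.2 x) ∧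
      (∃ z, ∀ b, (s' b).1.2 * (s' b).1.1 n = z * (s' b).1.2) ∧
      (s' false).1.1 n ∈ H ∧ (s' true).1.1 n ∉ H := by
    rintro n ⟨⟨a, h⟩, haG, ha, hh⟩
    obtain ⟨c₀, hc₀, c₁, hc₁, hg₀, hg₁, hH₀, hH₁, f, hf, hfS, hfa, hfc⟩ :=
      ha.exists_branching hG hfin ham H hopen hsmall haG (T n ∪ (T n).image (h⁻¹ : Perm M))
    have hfa' : ∀ i < n, f⁻¹ * a i = a i * f⁻¹ := fun i hi => by
      rw [inv_mul_eq_iff_eq_mul, ← mul_assoc, hfa i hi, mul_inv_cancel_right]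
    have hfc' : f⁻¹ * c₁ = c₀ * f⁻¹ := by
      rw [inv_mul_eq_iff_eq_mul, ← mul_assoc, hfc, mul_inv_cancel_right]
    refine ⟨fun b => match b with
      | false => ⟨(Function.update a n c₀, h), hmem hc₀ haG, hg₀, hh⟩
      | true => ⟨(Function.update a n c₁, h * f⁻¹), hmem hc₁ haG, hg₁, mul_mem hh (inv_mem hf)⟩,
      ?_, ?_, ?_, ⟨h * c₀ * h⁻¹, ?_⟩, by simpa using hH₀, by simpa using hH₁⟩
    · rintro (_ | _) i hi <;> simp [Function.update_of_ne hi.ne]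
    · rintro (_ | _) i hi z hz
      · exact hz
      · dsimp only at hz ⊢
        rw [mul_assoc, hfa' i hi, ← mul_assoc, hz, mul_assoc]
    · rintro (_ | _) x hx
      · rfl
      · exact congrArg h (f.symm_apply_eq.2 (hfS x hx).symm)
    · rintro (_ | _)
      · simp
      · simp [mul_assoc, hfc']
  choose F hFa hFconj hFT hFz hF₀ hF₁ using step
  let st (α : ℕ → Bool) (n : ℕ) : X n :=
    Nat.rec ⟨(fun _ => 1, 1), fun _ _ => one_mem _, Generic.zero _, one_mem _⟩
      (fun n s => F n s (α n)) n
  let D (α : ℕ → Bool) (n : ℕ) : Finset M := T n ∪ (T n).image ((st α n).1.2⁻¹ : Perm M)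
  have hDsucc : ∀ α n, ∀ x ∈ D α n, (st α (n + 1)).1.2 x = (st α n).1.2 x :=
    fun α n => hFT n (st α n) (α n)
  have hDmono : ∀ α, Monotone (D α) := by
    refine fun α => monotone_nat_of_le_succ fun n x hx => ?_
    rcases Finset.mem_union.1 hx with hxT | hxT
    · exact Finset.mem_union_left _ (hTmono n.le_succ hxT)
    · obtain ⟨y, hy, rfl⟩ := Finset.mem_image.1 hxT
      refine Finset.mem_union_right _ (Finset.mem_image.2 ⟨y, hTmono n.le_succ hy, ?_⟩)
      refine (st α (n + 1)).1.2.symm_apply_eq.2 ?_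
      rw [hDsucc α n _ hx]
      exact ((st α n).1.2.apply_symm_apply y).symm
  have hagree : ∀ α m m', m ≤ m' → ∀ x ∈ D α m, (st α m').1.2 x = (st α m).1.2 x := by
    intro α m m' h
    induction m', h using Nat.le_induction with
    | base => exact fun _ _ => rfl
    | succ m' h ih => exact fun x hx => (hDsucc α m' x (hDmono α h hx)).trans (ih x hx)
  have hex : ∀ α x, ∃ m, x ∈ D α m :=
    fun α x => let ⟨n, hn⟩ := hT x; ⟨n, Finset.mem_union_left _ hn⟩
  have hlim := fun α => exists_limit hG (fun n => (st α n).1.2) (D α)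
    (fun n => (st α n).2.2.2) (hagree α) (hex α)
    (fun x => let ⟨n, hn⟩ := hT x
      ⟨n, Finset.mem_union_right _ (Finset.mem_image_of_mem _ hn)⟩)
  choose h hhG hh using hlim
  have hconj : ∀ α n z, (st α (n + 1)).1.2 * (st α (n + 1)).1.1 n = z * (st α (n + 1)).1.2 →
      h α * (st α (n + 1)).1.1 n = z * h α := by
    intro α n z hz
    have hz' : ∀ m, n + 1 ≤ m → (st α m).1.1 n = (st α (n + 1)).1.1 n ∧
        (st α m).1.2 * (st α m).1.1 n = z * (st α m).1.2 := by
      intro m hm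
      induction m, hm using Nat.le_induction with
      | base => exact ⟨rfl, hz⟩
      | succ m hm ih =>
        have h1 : (st α (m + 1)).1.1 n = (st α m).1.1 n := hFa m (st α m) (α m) n hm
        exact ⟨h1.trans ih.1, by rw [h1]; exact hFconj m (st α m) (α m) n hm z ih.2⟩
    refine Equiv.ext fun x => ?_
    obtain ⟨m₁, hm₁⟩ := hex α x
    obtain ⟨m₂, hm₂⟩ := hex α ((st α (n + 1)).1.1 n x)
    let m := max (n + 1) (max m₁ m₂)
    have hm₁' := hDmono α (show m₁ ≤ m by omega) hm₁
    have hm₂' := hDmono α (show m₂ ≤ m by omega) hm₂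
    obtain ⟨h1, h2⟩ := hz' m (le_max_left _ _)
    rw [Perm.mul_apply, Perm.mul_apply, hh α m x hm₁', hh α m _ hm₂', ← h1]
    exact congrArg (fun f : Perm M => f x) h2
  have hne : ∀ α β n, (∀ i < n, α i = β i) → α n = false → β n = true → (h α)⁻¹ * h β ∉ H := by
    intro α β n hlt hα hβ hH
    have hst : st α n = st β n := by
      have : ∀ m ≤ n, st α m = st β m := by
        intro m hm
        induction m with
        | zero => rfl
        | succ m ih =>
          change F m (st α m) (α m) = F m (st β m) (β m)
          rw [ih (by omega), hlt m (by omega)]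
      exact this n le_rfl
    have hα' : st α (n + 1) = F n (st α n) false := by rw [← hα]
    have hβ' : st β (n + 1) = F n (st α n) true := by rw [← hβ, hst]
    obtain ⟨z, hz⟩ := hFz n (st α n)
    have h0 := hconj α n z (by rw [hα']; exact hz false)
    have h1 := hconj β n z (by rw [hβ']; exact hz true)
    rw [hα'] at h0
    rw [hβ'] at h1
    refine hF₁ n (st α n) ?_
    have : ((F n (st α n) true).1.1 n) =
        ((h α)⁻¹ * h β)⁻¹ * ((F n (st α n) false).1.1 n) * ((h α)⁻¹ * h β) := by
      rw [← eq_inv_mul_iff_mul_eq] at h0 h1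
      rw [h0, h1]
      group
    rw [this]
    exact mul_mem (mul_mem (inv_mem hH) (hF₀ n (st α n))) hH
  obtain ⟨α, β, hαβ, hH⟩ := hsmall h hhG
  have hex' := Function.ne_iff.1 hαβ
  let n := Nat.find hex'
  have hlt : ∀ i < n, α i = β i := fun i hi => not_not.1 (Nat.find_min hex' hi)
  have hn : α n ≠ β n := Nat.find_spec hex'
  cases hα : α n <;> cases hβ : β n
  · simp [hα, hβ] at hn
  · exact hne α β n hlt hα hβ hH
  · exact hne β α n (fun i hi => (hlt i hi).symm) hβ hα (by simpa using inv_mem hH)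
  · simp [hα, hβ] at hn

end PermutationGroup

section Extension

/-- Any partial injection between finite types of the same cardinality, presented by two indexed
families, extends to an equivalence. -/
lemma exists_equiv_extending {α β ι : Type*} [Finite α] [Finite β]
    (hcard : Nat.card α = Nat.card β) (p : ι → α) (q : ι → β)
    (hpq : ∀ i j, p i = p j ↔ q i = q j) : ∃ e : α ≃ β, ∀ i, e (p i) = q i := by
  classical
  have := Fintype.ofFinite α
  have := Fintype.ofFinite β
  obtain ⟨e₀⟩ : Nonempty (α ≃ β) := Finite.card_eq.1 hcard
  let f : α → β := fun x => if h : ∃ i, p i = x then q h.choose else e₀ x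
  have hf : ∀ i, f (p i) = q i := fun i => by
    have h : ∃ j, p j = p i := ⟨i, rfl⟩
    simp only [f, dif_pos h]
    exact (hpq _ _).1 h.choose_spec
  obtain ⟨g, hg⟩ := Set.MapsTo.exists_equiv_extend_of_card_eq (t := (Finset.univ : Finset β))
    (by rw [Finset.card_univ]; exact Fintype.card_congr e₀) (s := Set.range p) (f := f)
    (fun _ _ => by simp) (by
      rintro _ ⟨i, rfl⟩ _ ⟨j, rfl⟩ h
      rw [hf, hf] at h
      exact (hpq i j).2 h)
  refine ⟨g.trans (Equiv.subtypeUnivEquiv fun x => Finset.mem_univ x), fun i => ?_⟩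
  exact (hg _ ⟨i, rfl⟩).trans (hf i)

/-- A partial injection of a finite colored set preserving colors extends to a permutation
preserving colors. -/
lemma exists_perm_extending {A C : Type*} [Finite A] (c : A → C) (S : Set A) (φ : A → A)
    (hφ : Set.InjOn φ S) (hc : ∀ x ∈ S, c (φ x) = c x) :
    ∃ g : Equiv.Perm A, (∀ x, c (g x) = c x) ∧ ∀ x ∈ S, g x = φ x := by
  have h : ∀ k : C, ∃ e : Equiv.Perm {x // c x = k}, ∀ i : {x : {x // c x = k} // x.1 ∈ S},
      e i.1 = ⟨φ i.1.1, (hc _ i.2).trans i.1.2⟩ := fun k =>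
    exists_equiv_extending rfl (fun i : {x : {x // c x = k} // x.1 ∈ S} => i.1) _ fun i j => by
      rw [Subtype.mk.injEq, Subtype.ext_iff]
      exact (hφ.eq_iff i.2 j.2).symm
  choose e he using h
  have hce : ∀ x, c (e (c x) ⟨x, rfl⟩).1 = c x := fun x => (e (c x) ⟨x, rfl⟩).2
  have hinj : Function.Injective fun x => (e (c x) ⟨x, rfl⟩).1 := by
    intro x y hxy
    dsimp only at hxy
    have hcxy : c x = c y := by rw [← hce x, ← hce y, hxy]
    have key : ∀ k (hk : c y = k), (e (c y) ⟨y, rfl⟩).1 = (e k ⟨y, hk⟩).1 := by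
      rintro _ rfl; rfl
    rw [key _ hcxy.symm] at hxy
    exact congrArg Subtype.val ((e (c x)).injective (Subtype.ext hxy))
  exact ⟨Equiv.ofBijective _ (Finite.injective_iff_bijective.1 hinj), hce,
    fun x hx => congrArg Subtype.val (he (c x) ⟨⟨x, rfl⟩, hx⟩)⟩

/-- An embedding of structures that preserves colors. -/
structure ColEmb (L : FirstOrder.Language.{u, v}) {A B C : Type*} [L.Structure A] [L.Structure B]
    (a : A → C) (b : B → C) (f : A → B) : Prop where
  inj : Function.Injective f
  col : ∀ x, b (f x) = a x
  rel : ∀ {n : ℕ} (r : L.Relations n) (t : Fin n → A),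
    Structure.RelMap r (f ∘ t) ↔ Structure.RelMap r t

/-- `φ` restricts on `S` to an isomorphism between substructures that preserves colors. -/
structure PartialIso (L : FirstOrder.Language.{u, v}) {A C : Type*} [L.Structure A]
    (a : A → C) (S : Set A) (φ : A → A) : Prop where
  inj : Set.InjOn φ S
  col : ∀ x ∈ S, a (φ x) = a x
  rel : ∀ {n : ℕ} (r : L.Relations n) (t : Fin n → A), (∀ i, t i ∈ S) →
    (Structure.RelMap r (φ ∘ t) ↔ Structure.RelMap r t)

/-- The structure on `X` in a relational language with prescribed relations. -/
@[reducible] def relStructure (L : FirstOrder.Language.{u, v}) [L.IsRelational] {X : Type*}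
    (R : ∀ n, L.Relations n → (Fin n → X) → Prop) : L.Structure X where
  funMap f := isEmptyElim f
  RelMap r := R _ r

lemma ColEmb.comp {A B D C : Type*} [L.Structure A] [L.Structure B] [L.Structure D]
    {a : A → C} {b : B → C} {d : D → C} {g : B → D} {f : A → B}
    (hg : ColEmb L b d g) (hf : ColEmb L a b f) : ColEmb L a d (g ∘ f) where
  inj := hg.inj.comp hf.inj
  col x := (hg.col _).trans (hf.col x)
  rel r t := (hg.rel r (f ∘ t)).trans (hf.rel r t)

lemma ColEmb.id {A C : Type*} [L.Structure A] (a : A → C) : ColEmb L a a id :=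
  ⟨Function.injective_id, fun _ => rfl, fun _ _ => Iff.rfl⟩

lemma ColEmb.symm {A B C : Type*} [L.Structure A] [L.Structure B] {a : A → C} {b : B → C}
    {g : A ≃ B} (hg : ColEmb L a b g) : ColEmb L b a g.symm where
  inj := g.symm.injective
  col x := by rw [← hg.col, g.apply_symm_apply]
  rel r t := by
    rw [← hg.rel r]
    exact iff_of_eq (congrArg _ (funext fun i => g.apply_symm_apply _))

/-- Finite colored structures with finitely many nonempty relations have finite extensions to
which all partial isomorphisms extend as automorphisms. -/
theorem exists_extension [L.IsRelational] {A : Type} {C : Type*} [Finite A] [L.Structure A]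
    (hA : Sparse L A) (a : A → C) :
    ∃ (B : Type) (_ : L.Structure B) (_ : Finite B) (e : A → B) (b : B → C), ColEmb L a b e ∧
      ∀ S φ, PartialIso L a S φ →
        ∃ g : Equiv.Perm B, ColEmb L b b g ∧ ∀ x ∈ S, g (e x) = e (φ x) := by
  classical
  let R := {p : (n : ℕ) × L.Relations n | ∃ t : Fin p.1 → A, Structure.RelMap p.2 t}
  have : Finite R := hA
  let K := Σ p : R, (Fin p.1.1 → A) × Fin p.1.1
  let ind : ∀ p : R, (Fin p.1.1 → A) → ZMod 2 := fun p t =>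
    if Structure.RelMap p.1.2 t then 1 else 0
  obtain ⟨m, ⟨κ⟩⟩ := Finite.exists_equiv_fin K
  let B := A × (Fin m → ZMod 2)
  have hB : Finite B := inferInstance
  let : L.Structure B := relStructure L fun n r w => ∃ h : ⟨n, r⟩ ∈ R,
    ind ⟨⟨n, r⟩, h⟩ (Prod.fst ∘ w) + ∑ i, (w i).2 (κ ⟨⟨⟨n, r⟩, h⟩, Prod.fst ∘ w, i⟩) = 1
  refine ⟨B, inferInstance, hB, fun x => (x, 0), fun w => a w.1,
    ⟨fun x y h => congrArg Prod.fst h, fun _ => rfl, fun {n} r t => ?_⟩, fun S φ hφ => ?_⟩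
  · change (∃ h : ⟨n, r⟩ ∈ R, ind ⟨⟨n, r⟩, h⟩ t + ∑ i : Fin n, (0 : ZMod 2) = 1) ↔ _
    constructor
    · rintro ⟨h, h1⟩
      by_contra hr
      simp [ind, hr] at h1
    · exact fun hr => ⟨⟨t, hr⟩, by simp [ind, hr]⟩
  · obtain ⟨g, hgc, hgS⟩ := exists_perm_extending a S φ hφ.inj hφ.col
    have hf : ∀ (p : R) (t : Fin p.1.1 → A), ∃ f : Fin p.1.1 → ZMod 2,
        ∑ i, f i = ind p t + ind p (g ∘ t) ∧ ∀ i, t i ∈ S → f i = 0 := by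
      intro p t
      by_cases h : ∀ i, t i ∈ S
      · refine ⟨0, ?_, fun _ _ => rfl⟩
        have h1 : g ∘ t = φ ∘ t := funext fun i => hgS _ (h i)
        have h2 : ind p (g ∘ t) = ind p t := by simp only [ind, h1, hφ.rel p.1.2 t h]
        rw [h2, CharTwo.add_self_eq_zero]
        simp
      · push Not at h
        obtain ⟨j, hj⟩ := h
        refine ⟨Pi.single j (ind p t + ind p (g ∘ t)), by simp, fun i hi => ?_⟩
        exact Pi.single_eq_of_ne (by rintro rfl; exact hj hi) _
    choose f hfsum hf0 using hf
    let ψ : B → K → ZMod 2 := fun w k => w.2 (κ ⟨k.1, g.symm ∘ k.2.1, k.2.2⟩) +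
      if g.symm (k.2.1 k.2.2) = w.1 then f k.1 (g.symm ∘ k.2.1) k.2.2 else 0
    let θ : B → B := fun w => (g w.1, fun j => ψ w (κ.symm j))
    have hθκ : ∀ w k, (θ w).2 (κ k) = ψ w k := fun w k => by simp [θ]
    have hθ : Function.Injective θ := by
      rintro ⟨x, χ⟩ ⟨y, η⟩ h
      obtain rfl : x = y := g.injective (congrArg Prod.fst h)
      refine Prod.ext rfl (funext fun j => ?_)
      obtain ⟨⟨p, t, i⟩, rfl⟩ := κ.surjective j
      have := congrFun (congrArg Prod.snd h) (κ ⟨p, g ∘ t, i⟩)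
      rw [hθκ, hθκ] at this
      simpa [ψ, ← Function.comp_assoc] using this
    refine ⟨Equiv.ofBijective θ (Finite.injective_iff_bijective.1 hθ),
      ⟨hθ, fun w => hgc w.1, fun {n} r w => exists_congr fun h => ?_⟩, fun x hx => ?_⟩
    · have h1 : Prod.fst ∘ θ ∘ w = g ∘ (Prod.fst ∘ w) := rfl
      have h2 : g.symm ∘ g ∘ (Prod.fst ∘ w) = Prod.fst ∘ w := by
        rw [← Function.comp_assoc]; simp
      have h3 : ∑ i, (θ (w i)).2 (κ ⟨⟨⟨n, r⟩, h⟩, g ∘ (Prod.fst ∘ w), i⟩) =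
          ∑ i, (w i).2 (κ ⟨⟨⟨n, r⟩, h⟩, Prod.fst ∘ w, i⟩) +
            ∑ i, f ⟨⟨n, r⟩, h⟩ (Prod.fst ∘ w) i := by
        rw [← Finset.sum_add_distrib]
        refine Finset.sum_congr rfl fun i _ => ?_
        rw [hθκ]
        simp only [ψ, h2]
        simp
      change ind ⟨⟨n, r⟩, h⟩ (g ∘ (Prod.fst ∘ w)) +
        ∑ i, (θ (w i)).2 (κ ⟨⟨⟨n, r⟩, h⟩, g ∘ (Prod.fst ∘ w), i⟩) = 1 ↔ _
      rw [h3, hfsum]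
      have h4 : ∀ x y z : ZMod 2, x + (y + (z + x)) = z + y := by decide
      rw [h4]
    · refine Prod.ext (hgS x hx) (funext fun j => ?_)
      obtain ⟨⟨p, t, i⟩, rfl⟩ := κ.surjective j
      change (θ (x, 0)).2 _ = 0
      rw [hθκ]
      simp only [ψ, Pi.zero_apply, zero_add, ite_eq_right_iff]
      intro h
      exact hf0 _ _ _ (by simpa [h] using hx)

end Extension

section CliqueFaithful

variable {B C : Type*} [L.Structure B]

/-- A set with at least two elements that no automorphism moves into `W`. -/
def Unmovable (L : FirstOrder.Language.{u, v}) {B C : Type*} [L.Structure B] (b : B → C)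
    (W U : Set B) : Prop :=
  2 ≤ U.ncard ∧ ¬∃ g : Equiv.Perm B, ColEmb L b b g ∧ g '' U ⊆ W

lemma Unmovable.preimage {b : B → C} {W V : Set B} {g : Equiv.Perm B} (hg : ColEmb L b b g)
    (h : Unmovable L b W V) : Unmovable L b W (g ⁻¹' V) := by
  refine ⟨?_, fun ⟨k, hk, hkW⟩ => h.2 ⟨g.symm.trans k, hk.comp hg.symm, ?_⟩⟩
  · rw [← Equiv.image_symm_eq_preimage, Set.ncard_image_of_injective _ g.symm.injective]
    exact h.1
  · rwa [Equiv.coe_trans, Set.image_comp, Equiv.image_symm_eq_preimage]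

lemma unmovable_preimage_iff {b : B → C} {W V : Set B} {g : Equiv.Perm B}
    (hg : ColEmb L b b g) : Unmovable L b W (g ⁻¹' V) ↔ Unmovable L b W V :=
  ⟨fun h => by simpa [← Set.preimage_comp] using Unmovable.preimage hg.symm h,
    Unmovable.preimage hg⟩

/-- An element of `B` that can be moved into `W`, with a label for every unmovable set
containing it. -/
def Labeled (L : FirstOrder.Language.{u, v}) {B C : Type*} [L.Structure B] (b : B → C)
    (W : Set B) : Type _ :=
  {v : B × (∀ U : Set B, Fin (U.ncard - 2 + 1)) //
    (∃ g : Equiv.Perm B, ColEmb L b b g ∧ g v.1 ∈ W) ∧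
      ∀ U, ¬(Unmovable L b W U ∧ v.1 ∈ U) → v.2 U = 0}

namespace Labeled

variable {b : B → C} {W : Set B}

instance [Finite B] : Finite (Labeled L b W) :=
  inferInstanceAs (Finite {_v : B × (∀ U : Set B, Fin (U.ncard - 2 + 1)) // _})

/-- Distinct labeled elements are compatible if they have distinct underlying elements and
distinct labels at all unmovable sets that contain both. -/
def Compat (v w : Labeled L b W) : Prop :=
  (v.1.1 = w.1.1 → v = w) ∧
    ∀ U, Unmovable L b W U → v.1.1 ∈ U → w.1.1 ∈ U → v.1.2 U = w.1.2 U → v = w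

lemma Compat.refl (v : Labeled L b W) : Compat v v := ⟨fun _ => rfl, fun _ _ _ _ _ => rfl⟩

instance [L.IsRelational] : L.Structure (Labeled L b W) :=
  relStructure L fun _ r t => Structure.RelMap r (fun i => (t i).1.1) ∧ ∀ i j, Compat (t i) (t j)

lemma relMap_iff [L.IsRelational] {n : ℕ} (r : L.Relations n) (t : Fin n → Labeled L b W) :
    Structure.RelMap r t ↔
      Structure.RelMap r (fun i => (t i).1.1) ∧ ∀ i j, Compat (t i) (t j) := Iff.rfl

/-- An automorphism of `B` lifts to an automorphism of the labeled structure with prescribed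
values on a family of pairwise compatible elements. -/
theorem exists_lift [L.IsRelational] [Finite B] {g : Equiv.Perm B} (hg : ColEmb L b b g)
    {ι : Type*} (p q : ι → Labeled L b W) (hp : ∀ i j, Compat (p i) (p j))
    (hq : ∀ i j, Compat (q i) (q j)) (hpq : ∀ i, (q i).1.1 = g (p i).1.1) :
    ∃ θ : Equiv.Perm (Labeled L b W),
      ColEmb L (fun v : Labeled L b W => b v.1.1) (fun v => b v.1.1) θ ∧
        ∀ i, θ (p i) = q i := by
  classical
  have hcard : ∀ V : Set B, (g ⁻¹' V).ncard = V.ncard := fun V => by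
    rw [← Equiv.image_symm_eq_preimage, Set.ncard_image_of_injective _ g.symm.injective]
  have hτ : ∀ V : Set B, ∃ τ : Fin ((g ⁻¹' V).ncard - 2 + 1) ≃ Fin (V.ncard - 2 + 1),
      Unmovable L b W V → ∀ i : {i // g (p i).1.1 ∈ V},
        τ ((p i.1).1.2 (g ⁻¹' V)) = (q i.1).1.2 V := by
    intro V
    by_cases hV : Unmovable L b W V
    · obtain ⟨τ, hτ⟩ := exists_equiv_extending (by simp [hcard])
        (fun i : {i // g (p i).1.1 ∈ V} => (p i.1).1.2 (g ⁻¹' V)) (fun i => (q i.1).1.2 V) (by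
          rintro ⟨i, hi⟩ ⟨j, hj⟩
          constructor
          · intro h
            have h1 := (hp i j).2 _ (hV.preimage hg) hi hj h
            have h2 : q i = q j := (hq i j).1 (by rw [hpq, hpq, h1])
            rw [h2]
          · intro h
            have h1 := (hq i j).2 _ hV (by rwa [hpq]) (by rwa [hpq]) h
            have h2 : p i = p j := (hp i j).1 (g.injective (by rw [← hpq, ← hpq, h1]))
            rw [h2])
      exact ⟨τ, fun _ => hτ⟩
    · exact ⟨finCongr (by rw [hcard]), fun h => absurd h hV⟩
  choose τ hτ using hτ
  let θ : Labeled L b W → Labeled L b W := fun v =>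
    ⟨(g v.1.1, fun V => if Unmovable L b W V ∧ g v.1.1 ∈ V then τ V (v.1.2 (g ⁻¹' V)) else 0), by
      obtain ⟨k, hk, hkW⟩ := v.2.1
      exact ⟨g.symm.trans k, hk.comp hg.symm, by simpa using hkW⟩, fun U hU => if_neg hU⟩
  have hθ2 : ∀ v V, Unmovable L b W V → g v.1.1 ∈ V → (θ v).1.2 V = τ V (v.1.2 (g ⁻¹' V)) :=
    fun v V h1 h2 => if_pos ⟨h1, h2⟩
  have hsurj : ∀ U : Set B, ∃ V, g ⁻¹' V = U := fun U => ⟨g '' U, g.preimage_image U⟩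
  have hθ : Function.Injective θ := by
    intro v w h
    have h1 : v.1.1 = w.1.1 := g.injective (congrArg (fun x => x.1.1) h)
    refine Subtype.ext (Prod.ext h1 (funext fun U => ?_))
    obtain ⟨V, rfl⟩ := hsurj U
    by_cases hV : Unmovable L b W (g ⁻¹' V) ∧ v.1.1 ∈ g ⁻¹' V
    · have hV' := (unmovable_preimage_iff hg).1 hV.1
      refine (τ V).injective ?_
      rw [← hθ2 v V hV' hV.2, ← hθ2 w V hV' (by rw [← h1]; exact hV.2), h]
    · rw [v.2.2 _ hV, w.2.2 _ (by rwa [← h1])]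
  have hcompat : ∀ v w, Compat (θ v) (θ w) ↔ Compat v w := by
    intro v w
    constructor
    · refine fun h => ⟨fun h1 => hθ (h.1 (congrArg g h1)), fun U hU hv hw h1 => ?_⟩
      obtain ⟨V, rfl⟩ := hsurj U
      have hV := (unmovable_preimage_iff hg).1 hU
      exact hθ (h.2 V hV hv hw (by rw [hθ2 v V hV hv, hθ2 w V hV hw, h1]))
    · refine fun h => ⟨fun h1 => congrArg θ (h.1 (g.injective h1)), fun V hV hv hw h1 => ?_⟩
      rw [hθ2 v V hV hv, hθ2 w V hV hw] at h1
      exact congrArg θ (h.2 _ (hV.preimage hg) hv hw ((τ V).injective h1))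
  refine ⟨Equiv.ofBijective θ (Finite.injective_iff_bijective.1 hθ),
    ⟨hθ, fun v => hg.col _, fun r t => ?_⟩, fun i => ?_⟩
  · rw [relMap_iff, relMap_iff]
    exact and_congr (hg.rel r _) (forall_congr' fun i => forall_congr' fun j => hcompat _ _)
  · refine Subtype.ext (Prod.ext (hpq i).symm (funext fun V => ?_))
    by_cases hV : Unmovable L b W V ∧ g (p i).1.1 ∈ V
    · exact (hθ2 _ V hV.1 hV.2).trans (hτ V hV.1 ⟨i, hV.2⟩)
    · exact (if_neg hV).trans ((q i).2.2 V (by rwa [hpq])).symm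

/-- A set of pairwise compatible elements lies over a set that can be moved into `W`. -/
theorem exists_moved [Finite B] {Q : Set (Labeled L b W)}
    (hQ : ∀ v ∈ Q, ∀ w ∈ Q, Compat v w) :
    ∃ g : Equiv.Perm B, ColEmb L b b g ∧ ∀ v ∈ Q, g v.1.1 ∈ W := by
  have hinj : Set.InjOn (fun v : Labeled L b W => v.1.1) Q :=
    fun v hv w hw h => (hQ v hv w hw).1 h
  have hcard := hinj.ncard_image
  by_cases hU : Unmovable L b W ((fun v => v.1.1) '' Q)
  · have hlabel : Set.InjOn
        (fun v : Labeled L b W => v.1.2 ((fun v => v.1.1) '' Q)) Q :=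
      fun v hv w hw h => (hQ v hv w hw).2 _ hU ⟨v, hv, rfl⟩ ⟨w, hw, rfl⟩ h
    have h1 := hlabel.ncard_image
    have h2 := Set.ncard_le_card
      ((fun v : Labeled L b W => v.1.2 ((fun v => v.1.1) '' Q)) '' Q)
    rw [Nat.card_fin] at h2
    have := hU.1
    omega
  · by_cases h2 : 2 ≤ ((fun v : Labeled L b W => v.1.1) '' Q).ncard
    · obtain ⟨g, hg, hgW⟩ := not_not.1 (fun h => hU ⟨h2, h⟩)
      exact ⟨g, hg, fun v hv => hgW ⟨_, ⟨v, hv, rfl⟩, rfl⟩⟩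
    · rcases Q.eq_empty_or_nonempty with rfl | ⟨v, hv⟩
      · exact ⟨1, ColEmb.id b, fun v hv => hv.elim⟩
      · obtain ⟨g, hg, hgv⟩ := v.2.1
        refine ⟨g, hg, fun w hw => ?_⟩
        have : w = v := (Set.ncard_le_one (Set.toFinite Q)).1 (by omega) w hw v hv
        rwa [this]

end Labeled

/-- A set of elements any two of which occur together in a tuple of a basic relation. -/
def RelClique (L : FirstOrder.Language.{u, v}) {B : Type*} [L.Structure B] (Q : Set B) : Prop :=
  ∀ v ∈ Q, ∀ w ∈ Q, v ≠ w → ∃ (n : ℕ) (r : L.Relations n) (t : Fin n → B),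
    Structure.RelMap r t ∧ (∃ i, t i = v) ∧ ∃ j, t j = w

/-- Finite colored structures with finitely many nonempty relations have finite extensions to
which all partial isomorphisms extend as automorphisms, and in which all cliques are copies of
cliques of the given structure. -/
theorem exists_faithful_extension [L.IsRelational] {A : Type} [Finite A] [L.Structure A]
    (hA : Sparse L A) (a : A → C) :
    ∃ (B : Type) (_ : L.Structure B) (_ : Finite B) (e : A → B) (b : B → C), ColEmb L a b e ∧
      (∀ S φ, PartialIso L a S φ →
        ∃ g : Equiv.Perm B, ColEmb L b b g ∧ ∀ x ∈ S, g (e x) = e (φ x)) ∧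
      ∀ Q : Set B, RelClique L Q →
        ∃ g : Equiv.Perm B, ColEmb L b b g ∧ ∀ v ∈ Q, g v ∈ Set.range e := by
  classical
  obtain ⟨B, _, _, e, b, he, hext⟩ := exists_extension hA a
  let W := Set.range e
  have hν : ∀ U : Set B, ∃ ν : B → Fin (U.ncard - 2 + 1),
      Unmovable L b W U → Set.InjOn ν (U ∩ W) := by
    intro U
    by_cases hU : Unmovable L b W U
    · have hss : U ∩ W ⊂ U := Set.inter_ssubset_left_iff.2 fun h =>
        hU.2 ⟨1, ColEmb.id b, by simpa using h⟩
      have h1 := Set.ncard_lt_ncard hss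
      have := Fintype.ofFinite ↑(U ∩ W)
      have h2 : Fintype.card ↑(U ∩ W) ≤ Fintype.card (Fin (U.ncard - 2 + 1)) := by
        rw [Fintype.card_fin, ← Nat.card_eq_fintype_card, Nat.card_coe_set_eq]
        have := hU.1
        omega
      obtain ⟨ν⟩ := Function.Embedding.nonempty_of_card_le h2
      refine ⟨fun x => if h : x ∈ U ∩ W then ν ⟨x, h⟩ else 0, fun _ x hx y hy h => ?_⟩
      simp only [dif_pos hx, dif_pos hy] at h
      exact congrArg Subtype.val (ν.injective h)
    · exact ⟨0, fun h => absurd h hU⟩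
  choose ν hν using hν
  let e' : A → Labeled L b W := fun x =>
    ⟨(e x, fun U => if Unmovable L b W U ∧ e x ∈ U then ν U (e x) else 0),
      ⟨1, ColEmb.id b, x, rfl⟩, fun U hU => if_neg hU⟩
  have hcompat : ∀ x y, Labeled.Compat (e' x) (e' y) := by
    refine fun x y => ⟨fun h => congrArg e' (he.inj h), fun U hU hx hy h => ?_⟩
    have hx' : e x ∈ U := hx
    have hy' : e y ∈ U := hy
    have h' : ν U (e x) = ν U (e y) := by
      simpa [e', hU, hx', hy'] using h
    exact congrArg e' (he.inj (hν U hU ⟨hx, x, rfl⟩ ⟨hy, y, rfl⟩ h'))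
  refine ⟨Labeled L b W, inferInstance, inferInstance, e', fun v => b v.1.1,
    ⟨fun x y h => he.inj (congrArg (fun v => v.1.1) h), he.col, fun r t => ?_⟩,
    fun S φ hφ => ?_, fun Q hQ => ?_⟩
  · rw [Labeled.relMap_iff, ← he.rel r t]
    exact and_iff_left fun i j => hcompat _ _
  · obtain ⟨g, hg, hgS⟩ := hext S φ hφ
    obtain ⟨θ, hθ, hθS⟩ := Labeled.exists_lift hg (fun x : S => e' x) (fun x : S => e' (φ x))
      (fun _ _ => hcompat _ _) (fun _ _ => hcompat _ _) fun x => (hgS x x.2).symm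
    exact ⟨θ, hθ, fun x hx => hθS ⟨x, hx⟩⟩
  · have hQ' : ∀ v ∈ Q, ∀ w ∈ Q, Labeled.Compat v w := by
      intro v hv w hw
      by_cases h : v = w
      · rw [h]
        exact Labeled.Compat.refl w
      · obtain ⟨n, r, t, ht, ⟨i, rfl⟩, ⟨j, rfl⟩⟩ := hQ v hv w hw h
        exact ht.2 i j
    obtain ⟨g, hg, hgW⟩ := Labeled.exists_moved hQ'
    choose y hy using hgW
    obtain ⟨θ, hθ, hθS⟩ := Labeled.exists_lift hg (fun v : Q => v.1) (fun v : Q => e' (y v v.2))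
      (fun v w => hQ' _ v.2 _ w.2) (fun _ _ => hcompat _ _) fun v => hy v.1 v.2
    exact ⟨θ, hθ, fun v hv => ⟨y v hv, (hθS ⟨v, hv⟩).symm⟩⟩

end CliqueFaithful

section LinkTypes

variable [L.IsRelational]

/-- The embedding given by an injective map that preserves and reflects relations. -/
def embeddingOfRel {A B : Type*} [L.Structure A] [L.Structure B] (f : A → B)
    (hf : Function.Injective f)
    (hrel : ∀ {n : ℕ} (r : L.Relations n) (t : Fin n → A),
      Structure.RelMap r (f ∘ t) ↔ Structure.RelMap r t) : A ↪[L] B where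
  toFun := f
  inj' := hf
  map_fun' f := isEmptyElim f
  map_rel' := hrel

/-- The homomorphism given by a map that preserves relations. -/
def homOfRel {A B : Type*} [L.Structure A] [L.Structure B] (f : A → B)
    (hrel : ∀ {n : ℕ} (r : L.Relations n) (t : Fin n → A),
      Structure.RelMap r t → Structure.RelMap r (f ∘ t)) : A →[L] B where
  toFun := f
  map_fun' f := isEmptyElim f
  map_rel' := hrel

/-- The automorphism given by a permutation that preserves and reflects relations. -/
def equivOfRel {A : Type*} [L.Structure A] (g : Equiv.Perm A)
    (hrel : ∀ {n : ℕ} (r : L.Relations n) (t : Fin n → A),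
      Structure.RelMap r (g ∘ t) ↔ Structure.RelMap r t) : A ≃[L] A where
  toEquiv := g
  map_fun' f := isEmptyElim f
  map_rel' := hrel

/-- The structure on `X` pulled back from `A` along a map. -/
def pullback {X : Type} (A : Type*) [L.Structure A] (f : X → A) : Bundled.{0} L.Structure :=
  ⟨X, relStructure L fun _ r t => Structure.RelMap r (f ∘ t)⟩

/-- A structure embeds its pullbacks along injective maps. -/
def pullbackEmbedding {X : Type} {A : Type*} [L.Structure A] (f : X → A)
    (hf : Function.Injective f) : pullback (L := L) A f ↪[L] A :=
  embeddingOfRel (L := L) (A := pullback (L := L) A f) f hf fun _ _ => Iff.rfl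

omit [L.IsRelational] in
lemma relClique_range {A : Type*} [L.Structure A] {n : ℕ} {r : L.Relations n} {t : Fin n → A}
    (ht : Structure.RelMap r t) : RelClique L (Set.range t) := by
  rintro _ ⟨i, rfl⟩ _ ⟨j, rfl⟩ -
  exact ⟨n, r, t, ht, ⟨i, rfl⟩, ⟨j, rfl⟩⟩

variable {F Lk : Set (Bundled.{0} L.Structure)}

lemma sparse_of_mem_KLF (hLk : ∀ X ∈ Lk, Sparse L X) {A : Bundled.{0} L.Structure}
    (hA : A ∈ KLF Lk F) : Sparse L A := by
  have : Finite A := hA.1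
  have h : ∀ S : Set A, {p : (n : ℕ) × L.Relations n |
      ∃ t : Fin p.1 → A, Structure.RelMap p.2 t ∧ Set.range t = S}.Finite := by
    intro S
    rcases Set.eq_empty_or_nonempty {p : (n : ℕ) × L.Relations n |
      ∃ t : Fin p.1 → A, Structure.RelMap p.2 t ∧ Set.range t = S} with h | ⟨p, t, ht, rfl⟩
    · rw [h]
      exact Set.finite_empty
    · obtain ⟨X, hX, ⟨ψ⟩⟩ := hA.2.2 (pullback A (Subtype.val : Set.range t → A))
        ⟨inferInstanceAs (Finite (Set.range t)), Or.inr ⟨p.1, p.2, Set.rangeFactorization t, ht,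
          Set.rangeFactorization_surjective⟩⟩
        ⟨pullbackEmbedding _ Subtype.val_injective⟩
      refine (hLk X hX).subset ?_
      rintro q ⟨s, hs, hst⟩
      let s' : Fin q.1 → pullback (L := L) A (Subtype.val : Set.range t → A) :=
        fun i => ⟨s i, hst ▸ Set.mem_range_self i⟩
      exact ⟨ψ ∘ s', (ψ.map_rel q.2 s').2 hs⟩
  refine (Set.finite_iUnion h).subset ?_
  rintro p ⟨t, ht⟩
  exact Set.mem_iUnion.2 ⟨Set.range t, t, ht, rfl⟩

/-- Membership in `𝒦_{ℒℱ}` depends only on the cliques of a finite structure. -/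
lemma mem_KLF_of_cliques (hF : ∀ X ∈ F, Packed L X) {B : Bundled.{0} L.Structure} [Finite B]
    (h : ∀ Q : Set B, RelClique L Q → ∃ A ∈ KLF Lk F, ∃ ψ : Q → A, Function.Injective ψ ∧
      ∀ {n : ℕ} (r : L.Relations n) (t : Fin n → Q),
        Structure.RelMap r (ψ ∘ t) ↔ Structure.RelMap r (fun i => (t i : B))) :
    B ∈ KLF Lk F := by
  refine ⟨inferInstance, fun X hX => ⟨fun f => ?_⟩, fun Y hY ⟨ι⟩ => ?_⟩
  · obtain ⟨A, hA, ψ, -, hψ⟩ := h (Set.range f) (by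
      rintro _ ⟨x, rfl⟩ _ ⟨y, rfl⟩ hxy
      obtain ⟨n, r, t, ht, ⟨i, rfl⟩, ⟨j, rfl⟩⟩ := hF X hX x y fun h => hxy (by rw [h])
      exact ⟨n, r, f ∘ t, f.map_rel r t ht, ⟨i, rfl⟩, ⟨j, rfl⟩⟩)
    exact (hA.2.1 X hX).false (homOfRel (fun x => ψ ⟨f x, x, rfl⟩) fun r t ht =>
      (hψ r fun i => ⟨f (t i), t i, rfl⟩).2 (f.map_rel r t ht))
  · obtain ⟨A, hA, ψ, hψi, hψ⟩ := h (Set.range ι) (by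
      rintro _ ⟨x, rfl⟩ _ ⟨y, rfl⟩ hxy
      obtain ⟨-, ⟨-, hY⟩ | ⟨n, r, t, ht, hts⟩⟩ := hY
      · exact absurd (congrArg ι (Subsingleton.elim x y)) hxy
      · exact ⟨n, r, ι ∘ t, (ι.map_rel r t).2 ht, (hts x).imp fun i hi => congrArg ι hi,
          (hts y).imp fun i hi => congrArg ι hi⟩)
    refine hA.2.2 Y hY ⟨embeddingOfRel (fun x => ψ ⟨ι x, x, rfl⟩) (fun x y hxy => ?_)
      fun r t => (hψ r fun i => ⟨ι (t i), t i, rfl⟩).trans (ι.map_rel r t)⟩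
    exact ι.injective (congrArg Subtype.val (hψi hxy))

/-- Finite colored structures in `𝒦_{ℒℱ}` have finite extensions in `𝒦_{ℒℱ}` to which all
partial isomorphisms extend as automorphisms. -/
theorem exists_extension_KLF (hF : ∀ X ∈ F, Packed L X) (hLk : ∀ X ∈ Lk, Sparse L X)
    {T : Type*} [L.Structure T] {A : Bundled.{0} L.Structure} (hA : A ∈ KLF Lk F) (a : A →[L] T) :
    ∃ (B : Bundled.{0} L.Structure) (_ : B ∈ KLF Lk F) (e : A → B) (b : B →[L] T),
      ColEmb L a b e ∧ ∀ S φ, PartialIso L a S φ →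
        ∃ g : Equiv.Perm B, ColEmb L b b g ∧ ∀ x ∈ S, g (e x) = e (φ x) := by
  have : Finite A := hA.1
  obtain ⟨B, _, _, e, b, he, hext, hclique⟩ :=
    exists_faithful_extension (sparse_of_mem_KLF hLk hA) a
  refine ⟨⟨B, inferInstance⟩, mem_KLF_of_cliques (B := ⟨B, inferInstance⟩) hF fun Q hQ => ?_, e,
    homOfRel (L := L) b fun r t ht => ?_, he, hext⟩
  · obtain ⟨g, hg, hgQ⟩ := hclique Q hQ
    choose ψ hψ using fun v : Q => hgQ v v.2
    refine ⟨A, hA, ψ, fun v w h => Subtype.ext (g.injective ?_), fun r t => ?_⟩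
    · rw [← hψ, ← hψ, h]
    · rw [← he.rel r, ← hg.rel r fun i => (t i : B)]
      exact iff_of_eq (congrArg _ (funext fun i => hψ (t i)))
  · obtain ⟨g, hg, hgQ⟩ := hclique _ (relClique_range ht)
    choose y hy using fun i => hgQ (t i) ⟨i, rfl⟩
    have h1 : e ∘ y = g ∘ t := funext hy
    have h2 : b ∘ t = a ∘ y := funext fun i => by
      rw [Function.comp_apply, ← hg.col, ← hy, he.col]
      rfl
    rw [h2]
    exact a.map_rel r y ((he.rel r y).1 (h1 ▸ (hg.rel r t).2 ht))

end LinkTypes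

section StrongAutomorphisms

/-- The permutations of `M` that are automorphisms preserving the coloring `u`. -/
def strongAut (L : FirstOrder.Language.{u, v}) {M C : Type*} [L.Structure M] (u : M → C) :
    Subgroup (Equiv.Perm M) where
  carrier := {g | ColEmb L u u g}
  one_mem' := Set.mem_ofPred.2 (ColEmb.id u)
  mul_mem' hg hh := Set.mem_ofPred.2
    ((Set.mem_ofPred.1 hg).comp (Set.mem_ofPred.1 hh))
  inv_mem' hg := Set.mem_ofPred.2 (Set.mem_ofPred.1 hg).symm

lemma mem_strongAut {M C : Type*} [L.Structure M] {u : M → C} {g : Equiv.Perm M} :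
    g ∈ strongAut L u ↔ ColEmb L u u g := Set.mem_ofPred

lemma closedPerm_strongAut {M C : Type*} [L.Structure M] (u : M → C) :
    ClosedPerm (strongAut L u) := by
  classical
  refine fun g hg => mem_strongAut.2 ⟨g.injective, fun x => ?_, fun r t => ?_⟩
  · obtain ⟨g', hg', h⟩ := hg {x}
    rw [← h x (by simp), (mem_strongAut.1 hg').col]
  · obtain ⟨g', hg', h⟩ := hg (Finset.univ.image t)
    have : g ∘ t = g' ∘ t := funext fun i => (h _ (by simp)).symm
    rw [this, (mem_strongAut.1 hg').rel]

variable [L.IsRelational] {F Lk : Set (Bundled.{0} L.Structure)} {T : Type*} [L.Structure T]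
  {M : Bundled.{0} L.Structure} {u : M →[L] T}

omit [L.IsRelational] in
lemma inBar_of_embedding {K : Set (Bundled.{0} L.Structure)} (hM : InBar K M)
    {A : Bundled.{0} L.Structure} (f : A ↪[L] M) : InBar K A :=
  have := hM.1
  ⟨f.injective.countable, fun _ hB ⟨g⟩ => hM.2 _ hB ⟨f.comp g⟩⟩

omit [L.IsRelational] in
lemma inBar_of_mem_KLF {A : Bundled.{0} L.Structure} (hA : A ∈ KLF Lk F) :
    InBar (KLF Lk F) A :=
  have := hA.1
  ⟨inferInstance, fun _ hB ⟨f⟩ => ⟨hB, fun X hX => ⟨fun g =>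
    (hA.2.1 X hX).false (f.toHom.comp g)⟩, fun Y hY ⟨g⟩ => hA.2.2 Y hY ⟨f.comp g⟩⟩⟩

/-- Two colored embeddings of the same finite structure into a homogeneous structure differ by a
strong automorphism. -/
lemma exists_strongAut {K : Set (Bundled.{0} L.Structure)} (hM : InBar K M)
    (hhom : ColHomogeneous K M u) {A : Type} [L.Structure A] [Finite A] {a : A → T}
    {ι₁ ι₂ : A → M} (h₁ : ColEmb L a u ι₁) (h₂ : ColEmb L a u ι₂) :
    ∃ g ∈ strongAut L u, ∀ x, g (ι₁ x) = ι₂ x := by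
  let A' : Bundled.{0} L.Structure := ⟨A, inferInstance⟩
  let f₁ : A' ↪[L] M := embeddingOfRel ι₁ h₁.inj h₁.rel
  let f₂ : A' ↪[L] M := embeddingOfRel ι₂ h₂.inj h₂.rel
  obtain ⟨g, hgu, hg⟩ := hhom A' (u.comp f₁.toHom) (inBar_of_embedding hM f₁) ‹_› f₁ f₂
    (fun _ => rfl) fun x => (h₂.col x).trans (h₁.col x).symm
  exact ⟨g.toEquiv, mem_strongAut.2 ⟨g.injective, hgu, fun r t => g.map_rel r t⟩, hg⟩

/-- A universal homogeneous colored structure has the extension property. -/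
lemma exists_colEmb_extending (hM : InBar (KLF Lk F) M) (huniv : ColUniversal (KLF Lk F) M u)
    (hhom : ColHomogeneous (KLF Lk F) M u) {A : Type} [L.Structure A]
    {B : Bundled.{0} L.Structure} (hB : B ∈ KLF Lk F) {a : A → T} {b : B →[L] T} {m : A → M}
    {e : A → B} (hm : ColEmb L a u m) (he : ColEmb L a b e) :
    ∃ ι : B → M, ColEmb L b u ι ∧ ∀ x, ι (e x) = m x := by
  have : Finite B := hB.1
  have : Finite A := Finite.of_injective e he.inj
  obtain ⟨ι, hι⟩ := huniv B b (inBar_of_mem_KLF hB)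
  have hι' : ColEmb L b u ι := ⟨ι.injective, hι, fun r t => ι.map_rel r t⟩
  obtain ⟨g, hg, hge⟩ := exists_strongAut hM hhom (hι'.comp he) hm
  exact ⟨g ∘ ι, (mem_strongAut.1 hg).comp hι', hge⟩

lemma mem_KLF_pullback (hM : InBar (KLF Lk F) M) {X : Type} [Finite X] {f : X → M}
    (hf : Function.Injective f) : pullback M f ∈ KLF Lk F :=
  hM.2 _ (inferInstanceAs (Finite X)) ⟨pullbackEmbedding f hf⟩

theorem finiteExtension_strongAut (hF : ∀ X ∈ F, Packed L X) (hLk : ∀ X ∈ Lk, Sparse L X)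
    [DecidableEq M] (hM : InBar (KLF Lk F) M) (huniv : ColUniversal (KLF Lk F) M u)
    (hhom : ColHomogeneous (KLF Lk F) M u) : FiniteExtension (strongAut L u) := by
  classical
  intro n g hg S
  let E : Finset M := S ∪ (Finset.range n).biUnion fun i => S.image (g i)
  have hgE : ∀ i < n, ∀ x ∈ S, g i x ∈ E := fun i hi x hx => Finset.mem_union_right _
    (Finset.mem_biUnion.2 ⟨i, Finset.mem_range.2 hi, Finset.mem_image_of_mem _ hx⟩)
  let A : Bundled.{0} L.Structure := pullback M (Subtype.val : E → M)
  have hA : A ∈ KLF Lk F := mem_KLF_pullback hM Subtype.val_injective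
  have hm : ColEmb L (A := A) (fun x : E => u x) u Subtype.val :=
    ⟨Subtype.val_injective, fun _ => rfl, fun _ _ => Iff.rfl⟩
  obtain ⟨B, hB, e, b, he, hext⟩ := exists_extension_KLF hF hLk hA
    (u.comp (pullbackEmbedding (Subtype.val : E → M) Subtype.val_injective).toHom)
  obtain ⟨ι, hι, hιe⟩ := exists_colEmb_extending hM huniv hhom hB hm he
  have : Finite B := hB.1
  have := Fintype.ofFinite B
  have key : ∀ i, ∃ g' : Equiv.Perm M, i < n → g' ∈ strongAut L u ∧
      (∀ x ∈ S, g' x = g i x) ∧ ∀ x ∈ Finset.univ.image ι, g' x ∈ Finset.univ.image ι := by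
    intro i
    by_cases hi : i < n
    · let φ : A → A := fun x : E => if h : x.1 ∈ S then (⟨g i x.1, hgE i hi _ h⟩ : E) else x
      have hφ : ∀ (x : A) (hx : x.1 ∈ S), (φ x).1 = g i x.1 := fun x hx =>
        congrArg Subtype.val (dif_pos hx)
      obtain ⟨h, hh, hhS⟩ := hext {x | x.1 ∈ S} φ ⟨fun x hx y hy hxy => by
          refine Subtype.ext ((g i).injective ?_)
          rw [← hφ x hx, ← hφ y hy, hxy], fun x hx => by
          change u (φ x).1 = u x.1
          rw [hφ x hx]
          exact (mem_strongAut.1 (hg i hi)).col _, fun r t ht => by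
          change Structure.RelMap r (fun j => (φ (t j)).1) ↔ Structure.RelMap r fun j => (t j).1
          rw [← (mem_strongAut.1 (hg i hi)).rel r fun j => (t j).1]
          exact iff_of_eq (congrArg _ (funext fun j => hφ _ (ht j)))⟩
      obtain ⟨g', hg', hgι⟩ := exists_strongAut hM hhom hι (hι.comp hh)
      refine ⟨g', fun _ => ⟨hg', fun x hx => ?_, fun x hx => ?_⟩⟩
      · have hxE : x ∈ E := Finset.mem_union_left _ hx
        have h1 : ι (e (⟨x, hxE⟩ : E)) = x := hιe (⟨x, hxE⟩ : E)
        have h2 : h (e (⟨x, hxE⟩ : E)) = e (φ (⟨x, hxE⟩ : E)) := hhS (⟨x, hxE⟩ : E) hx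
        have h3 := hgι (e (⟨x, hxE⟩ : E))
        rw [Function.comp_apply, h2, hιe, h1] at h3
        rw [h3]
        exact hφ (⟨x, hxE⟩ : E) hx
      · obtain ⟨y, -, rfl⟩ := Finset.mem_image.1 hx
        rw [hgι]
        exact Finset.mem_image_of_mem _ (Finset.mem_univ _)
    · exact ⟨1, fun h => absurd h hi⟩
  choose g' hg' using key
  refine ⟨Finset.univ.image ι, fun x hx => ?_, g', hg'⟩
  exact Finset.mem_image.2 ⟨e (⟨x, Finset.mem_union_left _ hx⟩ : E), Finset.mem_univ _,
    hιe (⟨x, Finset.mem_union_left _ hx⟩ : E)⟩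

/-- The disjoint union of `E₁` (tagged by `true`) and `E₂ \ D` (tagged by `false`). -/
abbrev GluedSet {M : Type} (D E₁ E₂ : Finset M) : Type :=
  {p : M × Bool // (p.2 = true → p.1 ∈ E₁) ∧ (p.2 = false → p.1 ∈ E₂ ∧ p.1 ∉ D)}

namespace GluedSet

variable {M : Type} {D E₁ E₂ : Finset M}

instance : Finite (GluedSet D E₁ E₂) :=
  ((E₁.finite_toSet.union E₂.finite_toSet).prod Set.finite_univ).subset fun p hp => by
    rcases h : p.2
    · exact ⟨Or.inr (hp.2 h).1, Set.mem_univ _⟩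
    · exact ⟨Or.inl (hp.1 h), Set.mem_univ _⟩

/-- A family of elements of the first part. -/
def AllLeft {ι : Type*} (t : ι → GluedSet D E₁ E₂) : Prop := ∀ i, (t i).1.2 = true

/-- A family of elements of the second part. -/
def AllRight {ι : Type*} (t : ι → GluedSet D E₁ E₂) : Prop :=
  ∀ i, (t i).1.2 = true → (t i).1.1 ∈ D

lemma AllLeft.injective {ι : Type*} {t : ι → GluedSet D E₁ E₂} (ht : AllLeft t)
    (hinj : Function.Injective t) : Function.Injective fun i => (t i).1.1 :=
  fun i j h => hinj (Subtype.ext (Prod.ext h ((ht i).trans (ht j).symm)))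

lemma snd_eq_iff {p : GluedSet D E₁ E₂} (hp : p.1.2 = true → p.1.1 ∈ D) :
    p.1.2 = true ↔ p.1.1 ∈ D :=
  ⟨hp, fun h => by
    by_contra hp'
    exact (p.2.2 (by simpa using hp')).2 h⟩

lemma AllRight.injective {ι : Type*} {t : ι → GluedSet D E₁ E₂} (ht : AllRight t)
    (hinj : Function.Injective t) : Function.Injective fun i => (t i).1.1 :=
  fun i j h => hinj (Subtype.ext (Prod.ext h (Bool.eq_iff_iff.2 (by
    rw [snd_eq_iff (ht i), snd_eq_iff (ht j)]
    exact iff_of_eq (congrArg (· ∈ D) h)))))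

/-- The free amalgam of the substructures on `E₁` and `E₂` over `D`. -/
def amalgam (L : FirstOrder.Language.{u, v}) [L.IsRelational] {M : Type} [L.Structure M]
    (D E₁ E₂ : Finset M) : Bundled.{0} L.Structure :=
  ⟨GluedSet D E₁ E₂, relStructure L fun _ r t =>
    Structure.RelMap r (fun i => (t i).1.1) ∧ (AllLeft t ∨ AllRight t)⟩

end GluedSet

open GluedSet in
lemma amalgam_mem_KLF (hF : ∀ X ∈ F, Packed L X) (hM : InBar (KLF Lk F) M)
    (D E₁ E₂ : Finset M) : amalgam L D E₁ E₂ ∈ KLF Lk F := by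
  have : Finite (amalgam L D E₁ E₂) := inferInstanceAs (Finite (GluedSet D E₁ E₂))
  refine mem_KLF_of_cliques hF fun Q hQ => ?_
  let s : Q → GluedSet D E₁ E₂ := fun q => q.1
  have hs : Function.Injective s := Subtype.val_injective
  have hside : AllLeft s ∨ AllRight s := by
    by_contra h
    simp only [AllLeft, AllRight] at h
    push Not at h
    obtain ⟨⟨p, hp⟩, q, hq, hqD⟩ := h
    obtain ⟨n, r, t, ⟨-, ht⟩, ⟨i, hi⟩, ⟨j, hj⟩⟩ := hQ p p.2 q q.2 fun h => by
      have : s p = s q := h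
      exact hp (this ▸ hq)
    rcases ht with ht | ht
    · have := ht i
      rw [hi] at this
      exact hp this
    · have := ht j
      rw [hj] at this
      exact hqD (this hq)
  have hinj : Function.Injective fun q : Q => (s q).1.1 :=
    hside.elim (fun h => h.injective hs) fun h => h.injective hs
  refine ⟨pullback M fun q : Q => (s q).1.1, mem_KLF_pullback hM hinj, id,
    Function.injective_id, fun r t => (and_iff_left ?_).symm⟩
  exact hside.imp (fun h i => h (t i)) fun h i => h (t i)

open GluedSet in
theorem freeAmalgamation_strongAut (hF : ∀ X ∈ F, Packed L X) [DecidableEq M]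
    (hM : InBar (KLF Lk F) M) (huniv : ColUniversal (KLF Lk F) M u)
    (hhom : ColHomogeneous (KLF Lk F) M u) : FreeAmalgamation (strongAut L u) := by
  intro D E₁ E₂ hD₁ hD₂
  let P := amalgam L D E₁ E₂
  have hP : P ∈ KLF Lk F := amalgam_mem_KLF hF hM D E₁ E₂
  let π : P → M := fun p : GluedSet D E₁ E₂ => p.1.1
  let b : P →[L] T := homOfRel (fun p => u (π p)) fun r t ht => u.map_rel r (π ∘ t) ht.1
  let e₁ : E₁ → P := fun x =>
    (⟨(x, true), fun _ => x.2, fun h => by simp at h⟩ : GluedSet D E₁ E₂)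
  let e₂ : E₂ → P := fun x =>
    (⟨(x, decide (x.1 ∈ D)), fun h => hD₁ (by simpa using h), fun h => ⟨x.2, by simpa using h⟩⟩ :
      GluedSet D E₁ E₂)
  let A₁ : Bundled.{0} L.Structure := pullback M (Subtype.val : E₁ → M)
  let A₂ : Bundled.{0} L.Structure := pullback M (Subtype.val : E₂ → M)
  have hm₁ : ColEmb L (A := A₁) (fun x : E₁ => u x) u Subtype.val :=
    ⟨Subtype.val_injective, fun _ => rfl, fun _ _ => Iff.rfl⟩
  have hm₂ : ColEmb L (A := A₂) (fun x : E₂ => u x) u Subtype.val :=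
    ⟨Subtype.val_injective, fun _ => rfl, fun _ _ => Iff.rfl⟩
  have he₁ : ColEmb L (A := A₁) (fun x : E₁ => u x) b e₁ :=
    ⟨fun x y h => Subtype.ext (congrArg π h), fun _ => rfl,
      fun r t => and_iff_left (Or.inl fun _ => rfl)⟩
  have he₂ : ColEmb L (A := A₂) (fun x : E₂ => u x) b e₂ :=
    ⟨fun x y h => Subtype.ext (congrArg π h), fun _ => rfl,
      fun r t => and_iff_left (Or.inr fun _ h => of_decide_eq_true h)⟩
  obtain ⟨ι, hι, hι₂⟩ := exists_colEmb_extending hM huniv hhom hP hm₂ he₂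
  have : Finite P := hP.1
  have : Finite A₁ := inferInstanceAs (Finite E₁)
  obtain ⟨k, hk, hk₁⟩ := exists_strongAut hM hhom hm₁ (hι.comp he₁)
  refine ⟨k, hk, fun x hx => ?_, fun g₁ hg₁ g₂ hg₂ hE₁ hE₂ hD hg => ?_⟩
  · have h1 : e₁ ⟨x, hD₁ hx⟩ = e₂ ⟨x, hD₂ hx⟩ :=
      Subtype.ext (Prod.ext rfl (decide_eq_true hx).symm)
    exact (hk₁ (⟨x, hD₁ hx⟩ : E₁)).trans ((congrArg ι h1).trans (hι₂ (⟨x, hD₂ hx⟩ : E₂)))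
  rw [mem_strongAut] at hg₁ hg₂
  have hiff₁ : ∀ x, g₁ x ∈ D ↔ x ∈ D := by
    have h1 : D.image g₁ = D := Finset.eq_of_subset_of_card_le
      (Finset.image_subset_iff.2 hD) (Finset.card_image_of_injective _ g₁.injective).ge
    intro x
    conv_lhs => rw [← h1]
    exact g₁.injective.mem_finset_image
  have hiff₂ : ∀ x, g₂ x ∈ D ↔ x ∈ D := by
    have h1 : D.image g₂ = D := Finset.eq_of_subset_of_card_le
      (Finset.image_subset_iff.2 fun x hx => hg x hx ▸ hD x hx)
      (Finset.card_image_of_injective _ g₂.injective).ge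
    intro x
    conv_lhs => rw [← h1]
    exact g₂.injective.mem_finset_image
  let θ : P → P := fun p : GluedSet D E₁ E₂ =>
    (⟨(if p.1.2 = true then g₁ p.1.1 else g₂ p.1.1, p.1.2), fun h => by
      have h' : p.1.2 = true := h
      simpa only [if_pos h'] using hE₁ _ (p.2.1 h), fun h => by
      have h' : ¬p.1.2 = true := by simpa using h
      simp only [if_neg h']
      exact ⟨hE₂ _ (p.2.2 h).1, fun h1 => (p.2.2 h).2 ((hiff₂ _).1 h1)⟩⟩ : GluedSet D E₁ E₂)
  let snd : P → Bool := fun p : GluedSet D E₁ E₂ => p.1.2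
  have hθ₁ : ∀ p, snd p = true → π (θ p) = g₁ (π p) := fun p hp => if_pos hp
  have hθ₂ : ∀ p, ¬snd p = true → π (θ p) = g₂ (π p) := fun p hp => if_neg hp
  have hθ₂' : ∀ p, (snd p = true → π p ∈ D) → π (θ p) = g₂ (π p) := fun p hp => by
    by_cases h : snd p = true
    · rw [hθ₁ p h, hg _ (hp h)]
    · exact hθ₂ p h
  have hsnd : ∀ p, snd (θ p) = snd p := fun _ => rfl
  have hext : ∀ p q : P, π p = π q → snd p = snd q → p = q := fun p q h1 h2 =>
    Subtype.ext (Prod.ext h1 h2)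
  have hθ : ColEmb L b b θ := by
    refine ⟨fun p q h => ?_, fun p => ?_, fun r t => ?_⟩
    · have h2 : snd p = snd q := (hsnd p).symm.trans ((congrArg snd h).trans (hsnd q))
      refine hext p q ?_ h2
      have h1 := congrArg π h
      by_cases hp : snd p = true
      · rw [hθ₁ p hp, hθ₁ q (h2 ▸ hp)] at h1
        exact g₁.injective h1
      · rw [hθ₂ p hp, hθ₂ q (h2 ▸ hp)] at h1
        exact g₂.injective h1
    · change u (π (θ p)) = u (π p)
      by_cases hp : snd p = true
      · rw [hθ₁ p hp, hg₁.col]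
      · rw [hθ₂ p hp, hg₂.col]
    · have hR : ∀ i, (snd (t i) = true → π (θ (t i)) ∈ D) ↔
          (snd (t i) = true → π (t i) ∈ D) := fun i =>
        forall_congr' fun h => by rw [hθ₁ _ h, hiff₁]
      change (Structure.RelMap r (fun i => π (θ (t i))) ∧ ((∀ i, snd (θ (t i)) = true) ∨
        ∀ i, snd (θ (t i)) = true → π (θ (t i)) ∈ D)) ↔
        (Structure.RelMap r (fun i => π (t i)) ∧ ((∀ i, snd (t i) = true) ∨
        ∀ i, snd (t i) = true → π (t i) ∈ D))
      simp only [hsnd, hR]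
      refine and_congr_left ?_
      rintro (h | h)
      · rw [← hg₁.rel r fun i => π (t i)]
        exact iff_of_eq (congrArg _ (funext fun i => hθ₁ _ (h i)))
      · rw [← hg₂.rel r fun i => π (t i)]
        exact iff_of_eq (congrArg _ (funext fun i => hθ₂' _ (h i)))
  obtain ⟨q, hq, hqι⟩ := exists_strongAut hM hhom hι (hι.comp hθ)
  refine ⟨q, hq, fun x hx => ?_, fun x hx => ?_⟩
  · have h1 : θ (e₁ ⟨x, hx⟩) = e₁ ⟨g₁ x, hE₁ x hx⟩ := hext _ _ (hθ₁ _ rfl) rfl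
    have h2 : k x = ι (e₁ ⟨x, hx⟩) := hk₁ (⟨x, hx⟩ : E₁)
    have h3 : k (g₁ x) = ι (e₁ ⟨g₁ x, hE₁ x hx⟩) := hk₁ (⟨g₁ x, hE₁ x hx⟩ : E₁)
    rw [h2, h3, hqι, Function.comp_apply, h1]
  · have h1 : θ (e₂ ⟨x, hx⟩) = e₂ ⟨g₂ x, hE₂ x hx⟩ :=
      hext _ _ (hθ₂' _ fun h => of_decide_eq_true h) (decide_eq_decide.2 (hiff₂ x).symm)
    have h2 : ι (e₂ ⟨x, hx⟩) = x := hι₂ (⟨x, hx⟩ : E₂)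
    have h3 : ι (e₂ ⟨g₂ x, hE₂ x hx⟩) = g₂ x := hι₂ (⟨g₂ x, hE₂ x hx⟩ : E₂)
    rw [← h3, ← h1, ← Function.comp_apply (f := ι), ← hqι, h2]

end StrongAutomorphisms

section SmallIndex

variable [L.IsRelational]

/-- The small index property, read off from the group of strong automorphisms as permutations. -/
lemma hasSIPOn_of_exists_stabilizer {M C : Type} [L.Structure M] (u : M → C)
    (h : ∀ H : Subgroup (Equiv.Perm M),
      (∀ k : (ℕ → Bool) → Equiv.Perm M, (∀ α, k α ∈ strongAut L u) →
        ∃ α β, α ≠ β ∧ (k α)⁻¹ * k β ∈ H) →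
      ∃ D : Finset M, ∀ f ∈ strongAut L u, (∀ x ∈ D, f x = x) → f ∈ H) :
    HasSIPOn L M {f : M ≃[L] M | ∀ x, u (f x) = u x} := by
  rintro H - h1 hmul hinv ⟨S, hS, hcover⟩
  have htoPerm : Function.Injective (fun f : M ≃[L] M => f.toEquiv) :=
    fun f g hfg => Language.Equiv.ext fun x => congrArg (fun e : M ≃ M => e x) hfg
  let H' : Subgroup (Equiv.Perm M) :=
    { carrier := {g | ∃ f ∈ H, f.toEquiv = g}
      one_mem' := ⟨_, h1, rfl⟩
      mul_mem' := by
        rintro _ _ ⟨f, hf, rfl⟩ ⟨g, hg, rfl⟩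
        exact ⟨_, hmul f hf g hg, rfl⟩
      inv_mem' := by
        rintro _ ⟨f, hf, rfl⟩
        exact ⟨_, hinv f hf, rfl⟩ }
  have hlift : ∀ g ∈ strongAut L u, ∃ f : M ≃[L] M, f.toEquiv = g ∧ ∀ x, u (f x) = u x :=
    fun g hg => ⟨equivOfRel g (mem_strongAut.1 hg).rel, rfl, (mem_strongAut.1 hg).col⟩
  obtain ⟨D, hD⟩ := h H' (by
    intro k hk
    choose f hfk hfu using fun α => hlift (k α) (hk α)
    choose s hsS t ht hst using fun α => hcover (f α) (hfu α)
    have hninj : ¬Function.Injective fun α => (⟨s α, hsS α⟩ : S) := fun hinj =>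
      hS.not_ge (by simpa using Cardinal.lift_mk_le_lift_mk_of_injective hinj)
    simp only [Function.Injective] at hninj
    push Not at hninj
    obtain ⟨α, β, hs, hne⟩ := hninj
    refine ⟨α, β, hne, (t α).symm.comp (t β), hmul _ (hinv _ (ht α)) _ (ht β), ?_⟩
    rw [← hfk, ← hfk, hst α, hst β, ← Subtype.mk.inj hs]
    refine Equiv.ext fun x => ?_
    change (t α).toEquiv.symm (t β x) =
      (t α).toEquiv.symm ((s α).toEquiv.symm ((s α).toEquiv (t β x)))
    rw [Equiv.symm_apply_apply])
  refine ⟨D.card, fun i => D.equivFin.symm i, fun f hf hfx => ?_⟩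
  obtain ⟨f', hf', hff'⟩ := hD f.toEquiv
    (mem_strongAut.2 ⟨f.injective, hf, fun r t => f.map_rel r t⟩) fun x hx => by
      have := hfx (D.equivFin ⟨x, hx⟩)
      dsimp only at this
      rwa [Equiv.symm_apply_apply] at this
  exact htoPerm hff' ▸ hf'

end SmallIndex

/-- The class of finite `T`-colored structures over `𝒦_{ℒℱ}` has the
Hrushovski property, and the strong automorphism group of a universal homogeneous
`T`-colored structure in `𝒦_{ℒℱ}`-bar has the small index property. -/
theorem colored_KLF_hrushovski_SIP (L : FirstOrder.Language.{u, v}) [L.IsRelational]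
    (F Lk : Set (Bundled.{0} L.Structure))
    (hF : ∀ X ∈ F, Finite X ∧ Packed L X)
    (hLk : ∀ X ∈ Lk, IsLinkStructure X ∧ Sparse L X)
    (hLkc : Lk.Countable)
    (T : Type) [L.Structure T] [Countable T] :
    (∀ A : Bundled.{0} L.Structure, A ∈ KLF Lk F → ∀ a : A →[L] T,
      ∃ (B : Bundled.{0} L.Structure) (_ : B ∈ KLF Lk F) (e : A ↪[L] B) (b : B →[L] T),
        (∀ x, b (e x) = a x) ∧
        ∀ (S₁ S₂ : L.Substructure A) (p : S₁ ≃[L] S₂),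
          (∀ x : S₁, a ((p x : S₂) : A) = a (x : A)) →
          ∃ f : B ≃[L] B, (∀ y, b (f y) = b y) ∧
            ∀ x : S₁, f (e (x : A)) = e ((p x : S₂) : A)) ∧
    (∀ (Ub : Bundled.{0} L.Structure) (u : Ub →[L] T), InBar (KLF Lk F) Ub →
      ColUniversal (KLF Lk F) Ub u → ColHomogeneous (KLF Lk F) Ub u →
      HasSIPOn L Ub {f : Ub ≃[L] Ub | ∀ x, u (f x) = u x}) := by
  have hF' : ∀ X ∈ F, Packed L X := fun X hX => (hF X hX).2
  have hLk' : ∀ X ∈ Lk, Sparse L X := fun X hX => (hLk X hX).2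
  refine ⟨fun A hA a => ?_, fun Ub u hUb huniv hhom => ?_⟩
  · classical
    obtain ⟨B, hB, e, b, he, hext⟩ := exists_extension_KLF hF' hLk' hA a
    refine ⟨B, hB, embeddingOfRel e he.inj he.rel, b, he.col, fun S₁ S₂ p hp => ?_⟩
    let φ : A → A := fun x => if h : x ∈ S₁ then p ⟨x, h⟩ else x
    have hφ : ∀ x : S₁, φ x = p x := fun x => dif_pos x.2
    have hpart : PartialIso L a (S₁ : Set A) φ := by
      refine ⟨fun x hx y hy hxy => ?_, fun x hx => ?_, fun r t ht => ?_⟩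
      · rw [hφ ⟨x, hx⟩, hφ ⟨y, hy⟩] at hxy
        exact congrArg Subtype.val (p.injective (Subtype.ext hxy))
      · rw [hφ ⟨x, hx⟩, hp]
      · let t' : Fin _ → S₁ := fun i => ⟨t i, ht i⟩
        have h1 : φ ∘ t = S₂.subtype ∘ p ∘ t' := funext fun i => hφ (t' i)
        rw [h1, S₂.subtype.map_rel, p.map_rel]
        exact (S₁.subtype.map_rel r t').symm
    obtain ⟨g, hg, hgS⟩ := hext S₁ φ hpart
    refine ⟨equivOfRel g hg.rel, hg.col, fun x => ?_⟩
    rw [← hφ]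
    exact hgS x x.2
  · classical
    have := hUb.1
    exact hasSIPOn_of_exists_stabilizer u fun H hH =>
      exists_stabilizer_le (closedPerm_strongAut u)
        (finiteExtension_strongAut hF' hLk' hUb huniv hhom)
        (freeAmalgamation_strongAut hF' hUb huniv hhom) H hH

end Stmt14
end

section
/- Let G be a countable subgroup of Aut(T). Then there exists a G-universal, G-homogeneous T-colored structure (U,u) in 𝒞̄, and it is unique up to isomorphism of T-colored structures. -/
open FirstOrder Language CategoryTheory

universe u v

namespace Stmt18

variable {L : FirstOrder.Language.{u, v}}

/-- The age of `M` is contained in the class `C` of finite structures. -/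
def AgeIn (C : Set (Bundled.{0} L.Structure)) (M : Type*) [L.Structure M] : Prop :=
  ∀ A : Bundled.{0} L.Structure, Finite A → Nonempty (A ↪[L] M) → A ∈ C

/-- `A` is a countable structure whose age is contained in `C`, i.e. `A ∈ C̄`. -/
def InBar (C : Set (Bundled.{0} L.Structure)) (A : Bundled.{0} L.Structure) : Prop :=
  Countable A ∧ AgeIn C A

/-- A Fraïssé class of finite structures: nonempty, isomorphism-closed, countably many
isomorphism types, hereditary, with the joint embedding and amalgamation properties. -/
structure IsFraisseClass (C : Set (Bundled.{0} L.Structure)) : Prop where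
  nonempty : C.Nonempty
  finite : ∀ A ∈ C, Finite A
  isoInvariant : ∀ A B : Bundled.{0} L.Structure, Nonempty (A ≃[L] B) → (A ∈ C ↔ B ∈ C)
  countableTypes : ∃ S : Set (Bundled.{0} L.Structure), S.Countable ∧
    ∀ A ∈ C, ∃ B ∈ S, Nonempty (A ≃[L] B)
  hereditary : ∀ A ∈ C, ∀ B : Bundled.{0} L.Structure, Finite B → Nonempty (B ↪[L] A) → B ∈ C
  jep : ∀ A ∈ C, ∀ B ∈ C, ∃ D ∈ C, Nonempty (A ↪[L] D) ∧ Nonempty (B ↪[L] D)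
  amalgamation : ∀ A B₁ B₂ : Bundled.{0} L.Structure, A ∈ C → B₁ ∈ C → B₂ ∈ C →
    ∀ (f₁ : A ↪[L] B₁) (f₂ : A ↪[L] B₂),
      ∃ (D : Bundled.{0} L.Structure) (_ : D ∈ C) (g₁ : B₁ ↪[L] D) (g₂ : B₂ ↪[L] D),
        ∀ x, g₁ (f₁ x) = g₂ (f₂ x)

/-- `(P, g₁, g₂)` is a pushout of the pair of embeddings `(f₁, f₂)` in the category
`(K̄, →)` of countable structures with age contained in `K`, with homomorphisms. -/
def IsPushoutIn (K : Set (Bundled.{0} L.Structure)) {A B₁ B₂ : Bundled.{0} L.Structure}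
    (f₁ : A ↪[L] B₁) (f₂ : A ↪[L] B₂) (P : Bundled.{0} L.Structure)
    (g₁ : B₁ →[L] P) (g₂ : B₂ →[L] P) : Prop :=
  InBar K P ∧ (∀ x, g₁ (f₁ x) = g₂ (f₂ x)) ∧
  ∀ D : Bundled.{0} L.Structure, InBar K D →
    ∀ (h₁ : B₁ →[L] D) (h₂ : B₂ →[L] D), (∀ x, h₁ (f₁ x) = h₂ (f₂ x)) →
      ∃! h : P →[L] D, h.comp g₁ = h₁ ∧ h.comp g₂ = h₂

/-- `(P, g₁, g₂)` is a coproduct of `B₁, B₂` in the category `(K̄, →)`. -/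
def IsCoproductIn (K : Set (Bundled.{0} L.Structure)) (B₁ B₂ P : Bundled.{0} L.Structure)
    (g₁ : B₁ →[L] P) (g₂ : B₂ →[L] P) : Prop :=
  InBar K P ∧
  ∀ D : Bundled.{0} L.Structure, InBar K D → ∀ (h₁ : B₁ →[L] D) (h₂ : B₂ →[L] D),
    ∃! h : P →[L] D, h.comp g₁ = h₁ ∧ h.comp g₂ = h₂

/-- A strict Fraïssé class: a Fraïssé class in which every pair of embeddings with common
domain has a pushout in `(K̄,→)`, and every pair of members has a coproduct in `(K̄,→)`. -/
def IsStrictFraisse (K : Set (Bundled.{0} L.Structure)) : Prop :=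
  IsFraisseClass K ∧
  (∀ A B₁ B₂ : Bundled.{0} L.Structure, A ∈ K → B₁ ∈ K → B₂ ∈ K →
    ∀ (f₁ : A ↪[L] B₁) (f₂ : A ↪[L] B₂),
      ∃ (P : Bundled.{0} L.Structure) (g₁ : B₁ →[L] P) (g₂ : B₂ →[L] P),
        IsPushoutIn K f₁ f₂ P g₁ g₂) ∧
  (∀ B₁ B₂ : Bundled.{0} L.Structure, B₁ ∈ K → B₂ ∈ K →
    ∃ (P : Bundled.{0} L.Structure) (g₁ : B₁ →[L] P) (g₂ : B₂ →[L] P),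
      IsCoproductIn K B₁ B₂ P g₁ g₂)

/-- `C` is free in the strict Fraïssé class `K`: `C ⊆ K` and `C` is closed under the
canonical (pushout) amalgams and under finite coproducts taken in `(K̄,→)`. -/
def IsFreeIn (C K : Set (Bundled.{0} L.Structure)) : Prop :=
  C ⊆ K ∧
  (∀ A B₁ B₂ : Bundled.{0} L.Structure, A ∈ C → B₁ ∈ C → B₂ ∈ C →
    ∀ (f₁ : A ↪[L] B₁) (f₂ : A ↪[L] B₂) (P : Bundled.{0} L.Structure)
      (g₁ : B₁ →[L] P) (g₂ : B₂ →[L] P), IsPushoutIn K f₁ f₂ P g₁ g₂ → P ∈ C) ∧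
  (∀ B₁ B₂ : Bundled.{0} L.Structure, B₁ ∈ C → B₂ ∈ C →
    ∀ (P : Bundled.{0} L.Structure) (g₁ : B₁ →[L] P) (g₂ : B₂ →[L] P),
      IsCoproductIn K B₁ B₂ P g₁ g₂ → P ∈ C)

/-- `G` is (the carrier of) a subgroup of `Aut(T)`. -/
def IsAutSubgroupSet (L : FirstOrder.Language.{u, v}) (T : Type*) [L.Structure T]
    (G : Set (T ≃[L] T)) : Prop :=
  Language.Equiv.refl L T ∈ G ∧ (∀ f ∈ G, ∀ g ∈ G, f.comp g ∈ G) ∧ ∀ f ∈ G, f.symm ∈ G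

/-- `(U,u)` is a `G`-universal `T`-colored structure in `𝒞̄`: every countable `T`-colored
structure `(A,a)` in `𝒞̄` admits a `G`-embedding `(f,g)` into `(U,u)`. -/
def GColUniversal (C : Set (Bundled.{0} L.Structure)) {T : Type*} [L.Structure T]
    (G : Set (T ≃[L] T)) (Ub : Bundled.{0} L.Structure) (u : Ub →[L] T) : Prop :=
  ∀ (A : Bundled.{0} L.Structure) (a : A →[L] T), InBar C A →
    ∃ (f : A ↪[L] Ub) (g : T ≃[L] T), g ∈ G ∧ ∀ x, u (f x) = g (a x)

/-- `(U,u)` is a `G`-homogeneous `T`-colored structure in `𝒞̄`: any two `G`-embeddings of a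
finite `T`-colored structure `(A,a)` of `𝒞̄` into `(U,u)` differ by a `G`-automorphism. -/
def GColHomogeneous (C : Set (Bundled.{0} L.Structure)) {T : Type*} [L.Structure T]
    (G : Set (T ≃[L] T)) (Ub : Bundled.{0} L.Structure) (u : Ub →[L] T) : Prop :=
  ∀ (A : Bundled.{0} L.Structure) (a : A →[L] T), InBar C A → Finite A →
    ∀ (f₁ f₂ : A ↪[L] Ub) (g₁ g₂ : T ≃[L] T), g₁ ∈ G → g₂ ∈ G →
      (∀ x, u (f₁ x) = g₁ (a x)) → (∀ x, u (f₂ x) = g₂ (a x)) →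
      ∃ (f₃ : Ub ≃[L] Ub) (g₃ : T ≃[L] T), g₃ ∈ G ∧ (∀ y, u (f₃ y) = g₃ (u y)) ∧
        (∀ x, f₃ (f₁ x) = f₂ x) ∧ ∀ t, g₃ (g₁ t) = g₂ t

open Structure

section Helpers

variable {T M N : Type*}

/-- The structure induced on `α` by a map into a structure of a relational language. -/
abbrev pullStr [L.IsRelational] {α M : Type*} (S : L.Structure M) (f : α → M) :
    L.Structure α where
  funMap g := isEmptyElim g
  RelMap r x := S.RelMap r (f ∘ x)

/-- The structure induced on `α` by a map into a structure, as a bundled structure. -/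
def pull [L.IsRelational] {α : Type} {M : Type*} (S : L.Structure M) (f : α → M) :
    Bundled.{0} L.Structure := ⟨α, pullStr S f⟩

/-- In a relational language, an injective map preserving and reflecting all relations is an
embedding. -/
def mkEmb [L.IsRelational] [L.Structure M] [L.Structure N] (f : M → N)
    (hf : Function.Injective f)
    (h : ∀ (k : ℕ) (r : L.Relations k) (x : Fin k → M), RelMap r (f ∘ x) ↔ RelMap r x) :
    M ↪[L] N where
  toFun := f
  inj' := hf
  map_fun' g := isEmptyElim g
  map_rel' r x := h _ r x

/-- An injective map is an embedding of the structure it induces. -/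
def pullEmb [L.IsRelational] {α : Type} {M : Type*} [S : L.Structure M] (f : α → M)
    (hf : Function.Injective f) : pull S f ↪[L] M :=
  mkEmb (M := pull S f) f hf fun _ _ _ => Iff.rfl

/-- The empty substructure. -/
def emptyStr [L.IsRelational] {M : Type*} (S : L.Structure M) : Bundled.{0} L.Structure :=
  pull S Empty.elim

instance [L.IsRelational] {M : Type*} (S : L.Structure M) : IsEmpty (emptyStr S) :=
  inferInstanceAs (IsEmpty Empty)

/-- The embedding of the empty substructure. -/
def emptyEmb [L.IsRelational] {M : Type*} [S : L.Structure M] : emptyStr S ↪[L] M :=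
  pullEmb Empty.elim fun x => x.elim

/-- `F` is (the graph of) a color preserving partial isomorphism. -/
structure PIso (L : FirstOrder.Language.{u, v}) [L.Structure M] [L.Structure N]
    (m : M → T) (n : N → T) (F : Set (M × N)) : Prop where
  inj : ∀ p ∈ F, ∀ q ∈ F, p.1 = q.1 ↔ p.2 = q.2
  col : ∀ p ∈ F, m p.1 = n p.2
  rel : ∀ (k : ℕ) (r : L.Relations k) (x : Fin k → M × N), (∀ i, x i ∈ F) →
    (RelMap r (Prod.fst ∘ x) ↔ RelMap r (Prod.snd ∘ x))

section PIsoLemmas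

variable [L.Structure M] [L.Structure N] {m : M → T} {n : N → T} {F F' : Set (M × N)}

lemma PIso.mono (h : PIso L m n F) (hF : F' ⊆ F) : PIso L m n F' where
  inj p hp q hq := h.inj p (hF hp) q (hF hq)
  col p hp := h.col p (hF hp)
  rel k r x hx := h.rel k r x fun i => hF (hx i)

lemma PIso.swap (h : PIso L m n F) : PIso L n m (Prod.swap ⁻¹' F) where
  inj _ hp _ hq := (h.inj _ hp _ hq).symm
  col _ hp := (h.col _ hp).symm
  rel k r x hx := (h.rel k r (Prod.swap ∘ x) hx).symm

lemma exists_common_index {X ι : Type*} [Finite ι] {S : ℕ → Set X} (hS : Monotone S) (x : ι → X)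
    (h : ∀ i, ∃ k, x i ∈ S k) : ∃ k, ∀ i, x i ∈ S k := by
  choose f hf using h
  obtain ⟨k, hk⟩ := Set.finite_range f |>.bddAbove
  exact ⟨k, fun i => hS (hk ⟨i, rfl⟩) (hf i)⟩

lemma PIso.iUnion {S : ℕ → Set (M × N)} (hS : Monotone S) (h : ∀ k, PIso L m n (S k)) :
    PIso L m n (⋃ k, S k) where
  inj p hp q hq := by
    simp only [Set.mem_iUnion] at hp hq
    obtain ⟨i, hi⟩ := hp
    obtain ⟨j, hj⟩ := hq
    exact (h (max i j)).inj _ (hS (le_max_left i j) hi) _ (hS (le_max_right i j) hj)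
  col p hp := by
    obtain ⟨i, hi⟩ := Set.mem_iUnion.1 hp
    exact (h i).col p hi
  rel k r x hx := by
    obtain ⟨l, hl⟩ := exists_common_index hS x fun i => Set.mem_iUnion.1 (hx i)
    exact (h l).rel k r x hl

/-- A finite partial isomorphism can be extended to one meeting countably many sets, provided
each of them can be met by one-point extensions of finite partial isomorphisms. -/
lemma PIso.exists_generic {ι : Type*} [Countable ι] (K : ι → Set (M × N))
    (hK : ∀ i (F : Set (M × N)), F.Finite → PIso L m n F → ∃ z ∈ K i, PIso L m n (insert z F))
    (hfin : F.Finite) (hF : PIso L m n F) :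
    ∃ H : Set (M × N), F ⊆ H ∧ PIso L m n H ∧ ∀ i, ∃ z ∈ K i, z ∈ H := by
  have := Encodable.ofCountable ι
  let P := {F : Set (M × N) // F.Finite ∧ PIso L m n F}
  let D : ι → Order.Cofinal P := fun i =>
    { carrier := {p | ∃ z ∈ K i, z ∈ p.1}
      isCofinal := by
        rintro ⟨E, hE, hE'⟩
        obtain ⟨z, hz, h⟩ := hK i E hE hE'
        exact ⟨⟨insert z E, hE.insert z, h⟩, ⟨z, hz, Set.mem_insert _ _⟩, Set.subset_insert _ _⟩ }
  let s := Order.sequenceOfCofinals (⟨F, hfin, hF⟩ : P) D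
  have hs : Monotone s := Order.sequenceOfCofinals.monotone _ _
  refine ⟨⋃ k, (s k).1, fun z hz => Set.mem_iUnion.2 ⟨0, hz⟩,
    PIso.iUnion (fun a b h => hs h) fun k => (s k).2.2, fun i => ?_⟩
  obtain ⟨z, hz, hz'⟩ := Order.sequenceOfCofinals.encode_mem (⟨F, hfin, hF⟩ : P) D i
  exact ⟨z, hz, Set.mem_iUnion.2 ⟨_, hz'⟩⟩

lemma PIso.exists_embedding [L.IsRelational] (h : PIso L m n F) (ht : ∀ a, ∃ b, (a, b) ∈ F) :
    ∃ f : M ↪[L] N, (∀ x, n (f x) = m x) ∧ ∀ z ∈ F, f z.1 = z.2 := by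
  choose f hf using ht
  refine ⟨mkEmb f (fun a b hab => (h.inj _ (hf a) _ (hf b)).2 hab) fun k r x =>
    (h.rel k r (fun i => (x i, f (x i))) fun i => hf _).symm, fun x => (h.col _ (hf x)).symm,
    fun z hz => (h.inj _ (hf z.1) _ hz).1 rfl⟩

lemma PIso.exists_equiv [L.IsRelational] (h : PIso L m n F) (ht : ∀ a, ∃ b, (a, b) ∈ F)
    (ht' : ∀ b, ∃ a, (a, b) ∈ F) :
    ∃ f : M ≃[L] N, (∀ x, n (f x) = m x) ∧ ∀ z ∈ F, f z.1 = z.2 := by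
  obtain ⟨f, hf, hfF⟩ := h.exists_embedding ht
  have hs : Function.Surjective f := fun b => by
    obtain ⟨a, ha⟩ := ht' b
    exact ⟨a, hfF _ ha⟩
  exact ⟨{ Equiv.ofBijective f ⟨f.injective, hs⟩ with
    map_fun' := fun g => isEmptyElim g
    map_rel' := fun r x => f.map_rel r x }, hf, hfF⟩

end PIsoLemmas

/-- The colored structure `(N, n)` realizes every extension of a finite partial isomorphism
from a finite colored structure in `C`. -/
def Rich (C : Set (Bundled.{0} L.Structure)) [L.Structure T] [L.Structure N] (n : N → T) : Prop :=
  ∀ B ∈ C, ∀ (b : B →[L] T) (F : Set (B × N)), F.Finite → PIso L b n F →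
    ∃ f : B ↪[L] N, (∀ x, n (f x) = b x) ∧ ∀ z ∈ F, f z.1 = z.2

variable {C U : Set (Bundled.{0} L.Structure)}

lemma Rich.exists_insert [L.IsRelational] [L.Structure T] [L.Structure N] {n : N → T}
    (hn : Rich C n) {M : Type} [L.Structure M] (hM : AgeIn C M) (m : M →[L] T)
    {F : Set (M × N)} (hfin : F.Finite) (hF : PIso L m n F) (a : M) :
    ∃ b, PIso L m n (insert (a, b) F) := by
  let S : Set M := insert a (Prod.fst '' F)
  have hS : S.Finite := (hfin.image _).insert a
  let B : Bundled.{0} L.Structure := pull ‹L.Structure M› (Subtype.val : S → M)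
  let ι : B ↪[L] M := pullEmb _ Subtype.val_injective
  have hB : B ∈ C := hM B hS.to_subtype ⟨ι⟩
  obtain ⟨f, hf, hfF⟩ := hn B hB (m.comp ι.toHom) ((fun z : B × N => (ι z.1, z.2)) ⁻¹' F)
    (hfin.preimage fun x _ y _ h => by
      simp only [Prod.mk.injEq] at h
      exact Prod.ext (ι.injective h.1) h.2)
    { inj := fun p hp q hq => by
        rw [← hF.inj _ hp _ hq]
        exact ι.injective.eq_iff.symm
      col := fun p hp => hF.col _ hp
      rel := fun k r x hx => by
        rw [← ι.map_rel]
        exact hF.rel k r (fun i => (ι (x i).1, (x i).2)) hx }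
  refine ⟨f ⟨a, Set.mem_insert _ _⟩, ?_⟩
  have key : ∀ z ∈ insert (a, f ⟨a, Set.mem_insert _ _⟩) F, ∃ y : B, z = (ι y, f y) := by
    rintro z (rfl | hz)
    · exact ⟨⟨a, Set.mem_insert _ _⟩, rfl⟩
    · exact ⟨⟨z.1, Set.mem_insert_of_mem _ ⟨z, hz, rfl⟩⟩, Prod.ext rfl
        (hfF (⟨z.1, Set.mem_insert_of_mem _ ⟨z, hz, rfl⟩⟩, z.2) hz).symm⟩
  exact
    { inj := fun p hp q hq => by
        obtain ⟨y, rfl⟩ := key p hp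
        obtain ⟨y', rfl⟩ := key q hq
        exact ι.injective.eq_iff.trans f.injective.eq_iff.symm
      col := fun p hp => by
        obtain ⟨y, rfl⟩ := key p hp
        exact (hf y).symm
      rel := fun k r x hx => by
        choose y hy using fun i => key _ (hx i)
        obtain rfl : x = fun i => (ι (y i), f (y i)) := funext hy
        exact (ι.map_rel r y).trans (f.map_rel r y).symm }

lemma Rich.exists_embedding [L.IsRelational] [L.Structure T] [L.Structure N] {n : N → T}
    (hn : Rich C n) {M : Type} [L.Structure M] [Countable M] (hM : AgeIn C M) (m : M →[L] T)
    (h : PIso L m n (∅ : Set (M × N))) : ∃ f : M ↪[L] N, ∀ x, n (f x) = m x := by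
  obtain ⟨H, -, hH, ht⟩ := PIso.exists_generic (fun a : M => {z : M × N | z.1 = a})
    (fun a F hfin hF => by
      obtain ⟨b, hb⟩ := hn.exists_insert hM m hfin hF a
      exact ⟨(a, b), rfl, hb⟩) Set.finite_empty h
  obtain ⟨f, hf, -⟩ := hH.exists_embedding fun a => by
    obtain ⟨z, rfl, hz⟩ := ht a
    exact ⟨z.2, hz⟩
  exact ⟨f, hf⟩

lemma Rich.exists_equiv [L.IsRelational] [L.Structure T] {M N : Type} [L.Structure M]
    [L.Structure N] [Countable M] [Countable N] {m : M →[L] T} {n : N →[L] T}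
    (hm : Rich C m) (hn : Rich C n) (hM : AgeIn C M) (hN : AgeIn C N) {F : Set (M × N)}
    (hfin : F.Finite) (h : PIso L m n F) :
    ∃ f : M ≃[L] N, (∀ x, n (f x) = m x) ∧ ∀ z ∈ F, f z.1 = z.2 := by
  obtain ⟨H, hFH, hH, ht⟩ := PIso.exists_generic
    (Sum.elim (fun a : M => {z : M × N | z.1 = a}) fun b => {z | z.2 = b}) (by
      rintro (a | b) F hfin hF
      · obtain ⟨b, hb⟩ := hn.exists_insert hM m hfin hF a
        exact ⟨(a, b), rfl, hb⟩
      · obtain ⟨a, ha⟩ := hm.exists_insert hN n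
          (hfin.preimage Prod.swap_injective.injOn) hF.swap b
        refine ⟨(a, b), rfl, ha.swap.mono ?_⟩
        rintro z (rfl | hz)
        · exact Or.inl rfl
        · exact Or.inr hz) hfin h
  obtain ⟨f, hf, hf'⟩ := hH.exists_equiv (fun a => by
    obtain ⟨z, rfl, hz⟩ := ht (Sum.inl a)
    exact ⟨z.2, hz⟩) (fun b => by
    obtain ⟨z, rfl, hz⟩ := ht (Sum.inr b)
    exact ⟨z.1, hz⟩)
  exact ⟨f, hf, fun z hz => hf' z (hFH hz)⟩

lemma Rich.twist [L.Structure T] [L.Structure N] {n : N → T} (hn : Rich C n) (g : T ≃[L] T) :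
    Rich C (g ∘ n) := by
  intro B hB b F hfin hF
  obtain ⟨f, hf, hfF⟩ := hn B hB (g.symm.toHom.comp b) F hfin
    { inj := hF.inj
      rel := hF.rel
      col := fun p hp => by simpa using congrArg g.symm (hF.col p hp) }
  exact ⟨f, fun x => by simp [hf x], hfF⟩

lemma pIso_empty [L.IsRelational] (hC : IsFraisseClass C) {M N : Type} [SM : L.Structure M]
    [SN : L.Structure N] (hM : AgeIn C M) (hN : AgeIn C N) (m : M → T) (n : N → T) :
    PIso L m n (∅ : Set (M × N)) where
  inj _ hp := hp.elim
  col _ hp := hp.elim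
  rel k r x hx := by
    have hA : emptyStr SM ∈ C := hM _ inferInstance ⟨emptyEmb⟩
    have hB : emptyStr SN ∈ C := hN _ inferInstance ⟨emptyEmb⟩
    obtain ⟨D, -, ⟨f⟩, ⟨g⟩⟩ := hC.jep _ hA _ hB
    have : IsEmpty (Fin k) := ⟨fun i => hx i⟩
    have h1 := f.map_rel r isEmptyElim
    have h2 := g.map_rel r isEmptyElim
    have h3 := (emptyEmb (S := SM)).map_rel r isEmptyElim
    have h4 := (emptyEmb (S := SN)).map_rel r isEmptyElim
    rw [Subsingleton.elim (f ∘ _) (g ∘ isEmptyElim), h2] at h1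
    rw [Subsingleton.elim (Prod.fst ∘ x) (emptyEmb (S := SM) ∘ isEmptyElim),
      Subsingleton.elim (Prod.snd ∘ x) (emptyEmb (S := SN) ∘ isEmptyElim), h3, h4, h1]

lemma Rich.gColUniversal [L.IsRelational] {T : Type*} [L.Structure T] {G : Set (T ≃[L] T)}
    (hC : IsFraisseClass C) (hG : IsAutSubgroupSet L T G) {N : Bundled.{0} L.Structure}
    {n : N →[L] T} (hN : InBar C N) (hn : Rich C n) : GColUniversal C G N n := by
  intro A a hA
  have := hA.1
  obtain ⟨f, hf⟩ := hn.exists_embedding hA.2 a (pIso_empty hC hA.2 hN.2 _ _)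
  exact ⟨f, _, hG.1, hf⟩

lemma Rich.gColHomogeneous [L.IsRelational] {T : Type*} [L.Structure T] {G : Set (T ≃[L] T)}
    (hG : IsAutSubgroupSet L T G) {N : Bundled.{0} L.Structure}
    {n : N →[L] T} (hN : InBar C N) (hn : Rich C n) : GColHomogeneous C G N n := by
  intro A a hA hfin f₁ f₂ g₁ g₂ hg₁ hg₂ h₁ h₂
  have := hN.1
  have key : ∀ t, (g₂.comp g₁.symm) (g₁ t) = g₂ t := fun t => by simp
  obtain ⟨f, hf, hfF⟩ := Rich.exists_equiv (m := (g₂.comp g₁.symm).toHom.comp n) (n := n)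
    (hn.twist (g₂.comp g₁.symm)) hn hN.2 hN.2 (F := Set.range fun x => (f₁ x, f₂ x))
    (Set.finite_range _)
    { inj := by
        rintro _ ⟨x, rfl⟩ _ ⟨y, rfl⟩
        exact f₁.injective.eq_iff.trans f₂.injective.eq_iff.symm
      col := by
        rintro _ ⟨x, rfl⟩
        change (g₂.comp g₁.symm) (n (f₁ x)) = n (f₂ x)
        rw [h₁, h₂, key]
      rel := fun k r x hx => by
        choose y hy using hx
        obtain rfl : (fun i => (f₁ (y i), f₂ (y i))) = x := funext hy
        exact (f₁.map_rel r y).trans (f₂.map_rel r y).symm }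
  exact ⟨f, g₂.comp g₁.symm, hG.2.1 _ hg₂ _ (hG.2.2 _ hg₁), hf, fun x => hfF _ ⟨x, rfl⟩, key⟩

lemma ageIn_of_mem (hC : IsFraisseClass C) {B : Bundled.{0} L.Structure} (hB : B ∈ C) :
    AgeIn C B := fun A hA h => hC.hereditary B hB A hA h

lemma inBar_of_mem (hC : IsFraisseClass C) {B : Bundled.{0} L.Structure} (hB : B ∈ C) :
    InBar C B := ⟨have := hC.finite B hB; inferInstance, ageIn_of_mem hC hB⟩

lemma rich_of_gCol [L.IsRelational] {T : Type*} [L.Structure T] {G : Set (T ≃[L] T)}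
    (hC : IsFraisseClass C) (hG : IsAutSubgroupSet L T G) {N : Bundled.{0} L.Structure}
    {n : N →[L] T} (hu : GColUniversal C G N n) (hh : GColHomogeneous C G N n) :
    Rich C n := by
  intro B hB b F hfin hF
  obtain ⟨f, g, hg, hf⟩ := hu B b (inBar_of_mem hC hB)
  let A : Bundled.{0} L.Structure := pull B.str fun z : F => z.1.1
  have hAfin : Finite A := hfin.to_subtype
  let ι : A ↪[L] B := pullEmb (fun z : F => z.1.1)
    fun x y h => Subtype.ext (Prod.ext h ((hF.inj _ x.2 _ y.2).1 h))
  let κ : A ↪[L] N := mkEmb (M := A) (fun z : F => z.1.2)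
    (fun x y h => Subtype.ext (Prod.ext ((hF.inj _ x.2 _ y.2).2 h) h))
    fun k r x => (hF.rel k r (fun i => (x i).1) fun i => (x i).2).symm
  have hA : A ∈ C := hC.hereditary B hB A hAfin ⟨ι⟩
  obtain ⟨f₃, g₃, -, h1, h2, h3⟩ := hh A (b.comp ι.toHom) (inBar_of_mem hC hA) hAfin (f.comp ι) κ
    g (Language.Equiv.refl L T) hg hG.1 (fun x => hf _) (fun x => (hF.col _ x.2).symm)
  refine ⟨f₃.toEmbedding.comp f, fun x => ?_, fun z hz => h2 ⟨z, hz⟩⟩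
  change n (f₃ (f x)) = b x
  rw [h1, hf, h3]
  rfl

/-- A homomorphism which followed by some homomorphism is an embedding is an embedding. -/
lemma isEmb_of_comp {A B D : Type*} [L.Structure A] [L.Structure B] [L.Structure D]
    (g : A →[L] B) (h : B →[L] D) (e : A ↪[L] D) (he : ∀ x, h (g x) = e x) :
    Function.Injective g ∧
      ∀ (k : ℕ) (r : L.Relations k) (x : Fin k → A), RelMap r (g ∘ x) ↔ RelMap r x := by
  refine ⟨fun x y hxy => e.injective (by rw [← he, ← he, hxy]), fun k r x => ⟨fun H => ?_,
    g.map_rel r x⟩⟩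
  rw [← e.map_rel, show e ∘ x = h ∘ g ∘ x from funext fun i => (he (x i)).symm]
  exact h.map_rel r _ H

/-- Amalgamation of finite colored structures. -/
lemma exists_colored_amalgam [L.IsRelational] {T : Type} [L.Structure T] [Countable T]
    (hU : IsStrictFraisse U) (hfree : IsFreeIn C U) (hT : AgeIn U T)
    {A B₁ B₂ : Bundled.{0} L.Structure} (hA : A ∈ C) (hB₁ : B₁ ∈ C) (hB₂ : B₂ ∈ C)
    (f₁ : A ↪[L] B₁) (f₂ : A ↪[L] B₂) (b₁ : B₁ →[L] T) (b₂ : B₂ →[L] T)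
    (hb : ∀ x, b₁ (f₁ x) = b₂ (f₂ x)) :
    ∃ P ∈ C, ∃ (g₁ : B₁ ↪[L] P) (g₂ : B₂ ↪[L] P) (c : P →[L] T),
      (∀ x, g₁ (f₁ x) = g₂ (f₂ x)) ∧ (∀ x, c (g₁ x) = b₁ x) ∧ ∀ x, c (g₂ x) = b₂ x := by
  obtain ⟨P, g₁, g₂, hP⟩ := hU.2.1 A B₁ B₂ (hfree.1 hA) (hfree.1 hB₁) (hfree.1 hB₂) f₁ f₂
  obtain ⟨D, hD, e₁, e₂, he⟩ := hU.1.amalgamation A B₁ B₂ (hfree.1 hA) (hfree.1 hB₁)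
    (hfree.1 hB₂) f₁ f₂
  obtain ⟨h, ⟨h₁, h₂⟩, -⟩ := hP.2.2 D (inBar_of_mem hU.1 hD) e₁.toHom e₂.toHom he
  obtain ⟨c, ⟨c₁, c₂⟩, -⟩ := hP.2.2 (Bundled.of T) ⟨‹_›, hT⟩ b₁ b₂ hb
  obtain ⟨i₁, r₁⟩ := isEmb_of_comp g₁ h e₁ fun x => DFunLike.congr_fun h₁ x
  obtain ⟨i₂, r₂⟩ := isEmb_of_comp g₂ h e₂ fun x => DFunLike.congr_fun h₂ x
  exact ⟨P, hfree.2.1 A B₁ B₂ hA hB₁ hB₂ f₁ f₂ P g₁ g₂ hP, mkEmb g₁ i₁ r₁, mkEmb g₂ i₂ r₂, c,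
    hP.2.1, fun x => DFunLike.congr_fun c₁ x, fun x => DFunLike.congr_fun c₂ x⟩

/-- A finite structure from `C` on a subset of `ℕ × T`, colored by the second projection. -/
structure Cond (C : Set (Bundled.{0} L.Structure)) [L.IsRelational] (T : Type)
    [L.Structure T] where
  carrier : Set (ℕ × T)
  str : L.Structure (ℕ × T)
  mem : pull str (Subtype.val : carrier → ℕ × T) ∈ C
  hom : ∀ (k : ℕ) (r : L.Relations k) (x : Fin k → ℕ × T), (∀ i, x i ∈ carrier) →
    str.RelMap r x → RelMap r (Prod.snd ∘ x)

namespace Cond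

variable [L.IsRelational] {T : Type} [L.Structure T]

instance : Preorder (Cond C T) where
  le p q := p.carrier ⊆ q.carrier ∧ ∀ (k : ℕ) (r : L.Relations k) (x : Fin k → ℕ × T),
    (∀ i, x i ∈ p.carrier) → (p.str.RelMap r x ↔ q.str.RelMap r x)
  le_refl p := ⟨subset_rfl, fun _ _ _ _ => Iff.rfl⟩
  le_trans p q s h h' := ⟨h.1.trans h'.1, fun k r x hx =>
    (h.2 k r x hx).trans (h'.2 k r x fun i => h.1 (hx i))⟩

/-- The finite structure underlying a condition. -/
abbrev toBundled (p : Cond C T) : Bundled.{0} L.Structure :=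
  pull p.str (Subtype.val : p.carrier → ℕ × T)

/-- The coloring of a condition. -/
def color (p : Cond C T) : p.toBundled →[L] T where
  toFun := fun z : p.carrier => z.1.2
  map_fun' g := isEmptyElim g
  map_rel' r x h := p.hom _ r (fun i => (x i : p.carrier).1) (fun i => (x i : p.carrier).2) h

/-- A copy in `ℕ × T` of a colored structure in `C`. -/
lemma exists_of_injective (hC : IsFraisseClass C) {P : Bundled.{0} L.Structure} (hP : P ∈ C)
    (c : P →[L] T) (e : P → ℕ × T) (he : Function.Injective e) (hc : ∀ x, (e x).2 = c x) :
    ∃ p : Cond C T, p.carrier = Set.range e ∧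
      ∀ (k : ℕ) (r : L.Relations k) (x : Fin k → P), p.str.RelMap r (e ∘ x) ↔ RelMap r x := by
  let S : L.Structure (ℕ × T) :=
    { funMap := fun g => isEmptyElim g
      RelMap := fun r x => ∃ y, e ∘ y = x ∧ P.str.RelMap r y }
  have key : ∀ (k : ℕ) (r : L.Relations k) (x : Fin k → P),
      S.RelMap r (e ∘ x) ↔ RelMap r x := fun k r x =>
    ⟨fun ⟨y, hy, h⟩ => he.comp_left hy ▸ h, fun h => ⟨x, rfl, h⟩⟩
  let Q : Bundled.{0} L.Structure := pull S (Subtype.val : Set.range e → ℕ × T)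
  let ε : P ≃[L] Q :=
    { Equiv.ofInjective e he with
      map_fun' := fun g => isEmptyElim g
      map_rel' := fun r x => key _ r x }
  refine ⟨⟨Set.range e, S, (hC.isoInvariant P Q ⟨ε⟩).1 hP, ?_⟩, rfl, key⟩
  rintro k r x - ⟨y, rfl, h⟩
  rw [show Prod.snd ∘ e ∘ y = c ∘ y from funext fun i => hc (y i)]
  exact c.map_rel r y h

/-- The colored structure `(B, b)` embeds into the condition `p`, extending `F`. -/
def Realizes (p : Cond C T) {B : Bundled.{0} L.Structure} (b : B → T)
    (F : Set (B × (ℕ × T))) : Prop :=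
  ∃ f : B → ℕ × T, (∀ x, f x ∈ p.carrier) ∧ Function.Injective f ∧ (∀ x, (f x).2 = b x) ∧
    (∀ (k : ℕ) (r : L.Relations k) (x : Fin k → B), p.str.RelMap r (f ∘ x) ↔ RelMap r x) ∧
    ∀ z ∈ F, f z.1 = z.2

/-- `F` is a partial isomorphism from `(B, b)` to the condition `p`. -/
def Fits (p : Cond C T) {B : Bundled.{0} L.Structure} (b : B → T)
    (F : Set (B × (ℕ × T))) : Prop :=
  (∀ z ∈ F, z.2 ∈ p.carrier) ∧ letI := p.str; PIso L b (Prod.snd : ℕ × T → T) F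

lemma exists_injective_extension {P : Type} [Finite P] (s : Set (ℕ × T)) [Finite s]
    (c : P → T) (g : s → P) (hg : ∀ x, c (g x) = x.1.2) (hinj : Function.Injective g) :
    ∃ e : P → ℕ × T, Function.Injective e ∧ (∀ y, (e y).2 = c y) ∧ ∀ x, e (g x) = x.1 := by
  classical
  obtain ⟨K, hK⟩ := (Set.finite_range fun x : s => x.1.1).bddAbove
  obtain ⟨idx, hidx⟩ := exists_injective_nat P
  have hK' : ∀ x : s, x.1.1 ≤ K := fun x => hK ⟨x, rfl⟩
  let e : P → ℕ × T := fun y =>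
    if h : ∃ x, g x = y then h.choose.1 else (K + 1 + idx y, c y)
  have h1 : ∀ x, e (g x) = x.1 := fun x => by
    have h : ∃ x', g x' = g x := ⟨x, rfl⟩
    simp only [e, dif_pos h]
    exact congrArg Subtype.val (hinj h.choose_spec)
  have h2 : ∀ y, (¬ ∃ x, g x = y) → e y = (K + 1 + idx y, c y) := fun y h => dif_neg h
  refine ⟨e, fun y y' h => ?_, fun y => ?_, h1⟩
  · by_cases hy : ∃ x, g x = y <;> by_cases hy' : ∃ x, g x = y'
    · obtain ⟨x, rfl⟩ := hy
      obtain ⟨x', rfl⟩ := hy'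
      rw [h1, h1] at h
      rw [Subtype.ext h]
    · obtain ⟨x, rfl⟩ := hy
      rw [h1, h2 _ hy'] at h
      have := hK' x
      rw [h] at this
      omega
    · obtain ⟨x, rfl⟩ := hy'
      rw [h1, h2 _ hy] at h
      have := hK' x
      rw [← h] at this
      omega
    · rw [h2 _ hy, h2 _ hy', Prod.mk.injEq] at h
      exact hidx (by omega)
  · by_cases hy : ∃ x, g x = y
    · obtain ⟨x, rfl⟩ := hy
      rw [h1, hg]
    · rw [h2 _ hy]

lemma exists_realizes [Countable T] (hU : IsStrictFraisse U) (hC : IsFraisseClass C)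
    (hfree : IsFreeIn C U) (hT : AgeIn U T) (q : Cond C T) {B : Bundled.{0} L.Structure}
    (hB : B ∈ C) (b : B →[L] T) {F : Set (B × (ℕ × T))} (hfin : F.Finite) (hF : q.Fits b F) :
    ∃ p, q ≤ p ∧ p.Realizes b F := by
  obtain ⟨hFq, hF⟩ := hF
  let _ := q.str
  let A : Bundled.{0} L.Structure := pull B.str fun z : F => z.1.1
  let ι : A ↪[L] B := pullEmb (fun z : F => z.1.1)
    fun x y h => Subtype.ext (Prod.ext h ((hF.inj _ x.2 _ y.2).1 h))
  let κ : A ↪[L] q.toBundled := mkEmb (M := A) (N := q.toBundled)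
    (fun z : F => (⟨z.1.2, hFq _ z.2⟩ : q.carrier))
    (fun x y h => Subtype.ext (Prod.ext ((hF.inj _ x.2 _ y.2).2 (congrArg Subtype.val h))
      (congrArg Subtype.val h)))
    fun k r x => (hF.rel k r (fun i => (x i).1) fun i => (x i).2).symm
  have hA : A ∈ C := hC.hereditary B hB A hfin.to_subtype ⟨ι⟩
  obtain ⟨P, hP, g₁, g₂, c, hg, hc₁, hc₂⟩ := exists_colored_amalgam hU hfree hT hA hB q.mem ι κ b
    q.color fun x => hF.col _ x.2
  have : Finite P := hC.finite P hP
  have : Finite q.carrier := hC.finite _ q.mem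
  obtain ⟨e, he, hec, heg⟩ := exists_injective_extension q.carrier c g₂ hc₂ g₂.injective
  obtain ⟨p, hp, hpr⟩ := exists_of_injective hC hP c e he hec
  refine ⟨p, ⟨fun z hz => ?_, fun k r x hx => ?_⟩, e ∘ g₁, fun x => hp ▸ ⟨_, rfl⟩,
    he.comp g₁.injective, fun x => (hec _).trans (hc₁ x), fun k r x => ?_, fun z hz => ?_⟩
  · rw [hp]
    exact ⟨_, heg ⟨z, hz⟩⟩
  · have h1 := hpr k r (fun i => g₂ ⟨x i, hx i⟩)
    rw [show (e ∘ fun i => g₂ ⟨x i, hx i⟩) = x from funext fun i => heg _] at h1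
    rw [h1]
    exact (g₂.map_rel r fun i => ⟨x i, hx i⟩).symm
  · exact (hpr k r (g₁ ∘ x)).trans (g₁.map_rel r x)
  · exact (congrArg e (hg ⟨z, hz⟩)).trans (heg _)

end Cond

/-- Existence of a rich colored structure. -/
lemma exists_rich [L.IsRelational] {T : Type} [L.Structure T] [Countable T]
    (hU : IsStrictFraisse U) (hC : IsFraisseClass C) (hfree : IsFreeIn C U) (hT : AgeIn U T) :
    ∃ (N : Bundled.{0} L.Structure) (n : N →[L] T), InBar C N ∧ Rich C n := by
  obtain ⟨S, hS, hSC⟩ := hC.countableTypes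
  have hcS : Countable ↥(S ∩ C) := (hS.mono Set.inter_subset_left).to_subtype
  let ι := Σ B : ↥(S ∩ C), (B.1 →[L] T) × Finset (B.1 × (ℕ × T))
  have hcι : Countable ι := by
    have (B : ↥(S ∩ C)) : Countable ((B.1 →[L] T) × Finset (B.1 × (ℕ × T))) := by
      have := hC.finite _ B.2.2
      have : Countable (B.1 →[L] T) := DFunLike.coe_injective.countable
      infer_instance
    infer_instance
  have := Encodable.ofCountable ι
  let D : ι → Order.Cofinal (Cond C T) := fun i =>
    { carrier := {p | p.Realizes i.2.1 (i.2.2 : Set _) ∨ ∀ q ≥ p, ¬ q.Fits i.2.1 (i.2.2 : Set _)}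
      isCofinal := fun p => by
        by_cases h : ∀ q ≥ p, ¬ q.Fits i.2.1 (i.2.2 : Set _)
        · exact ⟨p, Or.inr h, le_rfl⟩
        · push Not at h
          obtain ⟨q, hpq, hq⟩ := h
          obtain ⟨s, hqs, hs⟩ := q.exists_realizes hU hC hfree hT i.1.2.2 i.2.1
            (Finset.finite_toSet _) hq
          exact ⟨s, Or.inl hs, hpq.trans hqs⟩ }
  obtain ⟨p₀⟩ : Nonempty (Cond C T) := by
    obtain ⟨A, hA⟩ := hC.nonempty
    have hE : emptyStr A.str ∈ C := hC.hereditary A hA _ inferInstance ⟨emptyEmb⟩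
    have hET := pIso_empty hU.1 (ageIn_of_mem hU.1 (hfree.1 hE)) hT
      (fun _ => ()) fun _ => ()
    let c : emptyStr A.str →[L] T :=
      { toFun := isEmptyElim
        map_fun' := fun g => isEmptyElim g
        map_rel' := fun {k} r x h => by
          have : IsEmpty (Fin k) := ⟨fun i => isEmptyElim (x i)⟩
          have := (hET.rel k r isEmptyElim isEmptyElim).1
          rw [Subsingleton.elim (Prod.fst ∘ _) x] at this
          rw [Subsingleton.elim (isEmptyElim ∘ x) (Prod.snd ∘ isEmptyElim)]
          exact this h }
    obtain ⟨p, -⟩ := Cond.exists_of_injective hC hE c isEmptyElim (fun x => isEmptyElim x)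
      fun x => isEmptyElim x
    exact ⟨p⟩
  let s := Order.sequenceOfCofinals p₀ D
  have hs : Monotone s := Order.sequenceOfCofinals.monotone _ _
  have hsc : Monotone fun k => (s k).carrier := fun i j h => (hs h).1
  let Ω := {z : ℕ × T // ∃ k, z ∈ (s k).carrier}
  let str : L.Structure Ω :=
    { funMap := fun g => isEmptyElim g
      RelMap := fun r x => ∃ k, (∀ i, (x i).1 ∈ (s k).carrier) ∧
        (s k).str.RelMap r (Subtype.val ∘ x) }
  have hrel : ∀ (l k : ℕ) (r : L.Relations k) (x : Fin k → Ω), (∀ i, (x i).1 ∈ (s l).carrier) →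
      (str.RelMap r x ↔ (s l).str.RelMap r (Subtype.val ∘ x)) := by
    refine fun l k r x hx => ⟨fun ⟨l', hl', h⟩ => ?_, fun h => ⟨l, hx, h⟩⟩
    exact ((hs (le_max_left l l')).2 k r _ hx).2 (((hs (le_max_right l l')).2 k r _ hl').1 h)
  let n : Ω →[L] T :=
    { toFun := fun z => z.1.2
      map_fun' := fun g => isEmptyElim g
      map_rel' := fun r x ⟨l, hl, h⟩ => (s l).hom _ r _ hl h }
  refine ⟨⟨Ω, str⟩, n, ⟨inferInstanceAs (Countable Ω), fun A hA ⟨f⟩ => ?_⟩, ?_⟩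
  · obtain ⟨l, hl⟩ := exists_common_index hsc (fun x => (f x).1) fun x => (f x).2
    refine hC.hereditary _ (s l).mem A hA ⟨mkEmb (N := (s l).toBundled)
      (fun x => (⟨(f x).1, hl x⟩ : (s l).carrier))
      (fun x y h => f.injective (Subtype.ext (congrArg (fun z : (s l).carrier => z.1) h))) fun k r x => ?_⟩
    exact (hrel l k r (f ∘ x) fun i => hl _).symm.trans (f.map_rel r x)
  have hrich : ∀ B ∈ S ∩ C, ∀ (b : B →[L] T) (F : Set (B × Ω)), F.Finite → PIso L b n F →
      ∃ f : B ↪[L] Ω, (∀ x, n (f x) = b x) ∧ ∀ z ∈ F, f z.1 = z.2 := by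
    intro B hB b F hfin hF
    let E : Set (B × (ℕ × T)) := (fun z => (z.1, z.2.1)) '' F
    have hE : E.Finite := hfin.image _
    let i : ι := ⟨⟨B, hB⟩, b, hE.toFinset⟩
    have hi := Order.sequenceOfCofinals.encode_mem p₀ D i
    set l := Encodable.encode i + 1
    change (s l).Realizes b (hE.toFinset : Set _) ∨
      ∀ q ≥ s l, ¬ q.Fits b (hE.toFinset : Set _) at hi
    rw [hE.coe_toFinset] at hi
    obtain ⟨f, hfl, hf, hfb, hfr, hfE⟩ | hi := hi
    · refine ⟨mkEmb (fun x => ⟨f x, l, hfl x⟩) (fun x y h => hf (congrArg Subtype.val h))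
        fun k r x => (hrel l k r _ fun i => hfl _).trans (hfr k r x), hfb, fun z hz => ?_⟩
      exact Subtype.ext (hfE (z.1, z.2.1) ⟨z, hz, rfl⟩)
    · exfalso
      have := hfin.to_subtype
      obtain ⟨l', hl'⟩ := exists_common_index hsc (fun z : F => z.1.2.1) fun z => z.1.2.2
      refine hi (s (max l l')) (hs (le_max_left _ _)) ⟨?_, ?_⟩
      · rintro _ ⟨z, hz, rfl⟩
        exact hsc (le_max_right l l') (hl' ⟨z, hz⟩)
      · let _ := (s (max l l')).str
        exact
          { inj := by
              rintro _ ⟨z, hz, rfl⟩ _ ⟨z', hz', rfl⟩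
              exact (hF.inj z hz z' hz').trans Subtype.ext_iff
            col := by
              rintro _ ⟨z, hz, rfl⟩
              exact hF.col z hz
            rel := fun k r x hx => by
              choose y hy hyx using hx
              obtain rfl : (fun i => ((y i).1, (y i).2.1)) = x := funext hyx
              exact (hF.rel k r y hy).trans
                (hrel _ k r _ fun i => hsc (le_max_right l l') (hl' ⟨y i, hy i⟩)) }
  intro B hB b F hfin hF
  obtain ⟨B', hB', ⟨ε⟩⟩ := hSC B hB
  obtain ⟨f, hf, hfF⟩ := hrich B' ⟨hB', (hC.isoInvariant _ _ ⟨ε⟩).1 hB⟩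
    (b.comp ε.symm.toHom) ((fun z => (ε.symm z.1, z.2)) ⁻¹' F)
    (hfin.preimage fun x _ y _ h => by
      simp only [Prod.mk.injEq] at h
      exact Prod.ext (ε.symm.injective h.1) h.2)
    { inj := fun p hp q hq => by
        rw [← hF.inj _ hp _ hq]
        exact ε.symm.injective.eq_iff.symm
      col := fun p hp => hF.col _ hp
      rel := fun k r x hx => by
        rw [← ε.symm.map_rel]
        exact hF.rel k r (fun i => (ε.symm (x i).1, (x i).2)) hx }
  exact ⟨f.comp ε.toEmbedding, fun x => (hf (ε x)).trans (congrArg b (ε.symm_apply_apply x)),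
    fun z hz => hfF (ε z.1, z.2) (by simpa using hz)⟩

end Helpers

/-- For every countable subgroup `G` of `Aut(T)` there exists a
`G`-universal, `G`-homogeneous `T`-colored structure in `𝒞̄`, unique up to isomorphism of
`T`-colored structures. -/
theorem exists_unique_G_universal_homogeneous (L : FirstOrder.Language.{u, v})
    [L.IsRelational] (U C : Set (Bundled.{0} L.Structure))
    (hU : IsStrictFraisse U) (hC : IsFraisseClass C) (hfree : IsFreeIn C U)
    (T : Type) [L.Structure T] [Countable T] (hT : AgeIn U T)
    (G : Set (T ≃[L] T)) (hG : IsAutSubgroupSet L T G) (hGc : G.Countable) :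
    ∃ (Ub : Bundled.{0} L.Structure) (u : Ub →[L] T), InBar C Ub ∧
      GColUniversal C G Ub u ∧ GColHomogeneous C G Ub u ∧
      ∀ (Ub' : Bundled.{0} L.Structure) (u' : Ub' →[L] T), InBar C Ub' →
        GColUniversal C G Ub' u' → GColHomogeneous C G Ub' u' →
        ∃ j : Ub ≃[L] Ub', ∀ x, u' (j x) = u x := by
  obtain ⟨N, n, hN, hn⟩ := exists_rich hU hC hfree hT
  refine ⟨N, n, hN, hn.gColUniversal hC hG hN, hn.gColHomogeneous hG hN,
    fun N' n' hN' hu hh => ?_⟩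
  have := hN.1
  have := hN'.1
  obtain ⟨j, hj, -⟩ := hn.exists_equiv (rich_of_gCol hC hG hu hh) hN.2 hN'.2 Set.finite_empty
    (pIso_empty hC hN.2 hN'.2 n n')
  exact ⟨j, hj⟩

end Stmt18
end
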